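/- Let d ≥ 5 and let P ⊂ ℝ^d be a d-dimensional canonical lattice simplex. Then mult(P) = 3·(s_{d-1} − 1)² if and only if P is unimodularly equivalent to conv{0, s_1 e_1, …, s_{d-2} e_{d-2}, 3(s_{d-1}−1) e_{d-1}, 3(s_{d-1}−1) e_d} − (1, …, 1). -/

import Mathlib

/-- Shifted Sylvester sequence: `sylv n` is the Sylvester number `s (n+1)`,
so `sylv 0 = s 1 = 2`, `sylv 1 = s 2 = 3`, `sylv 2 = s 3 = 7`, `sylv 3 = s 4 = 43`, …
It satisfies `s (i+1) = s i * (s i - 1) + 1 = s 1 * ⋯ * s i + 1`. -/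
def sylv : ℕ → ℕ
  | 0 => 2
  | n + 1 => sylv n * (sylv n - 1) + 1

/-- The canonical embedding of integer vectors into real vectors. -/
def toR {d : ℕ} (x : Fin d → ℤ) : Fin d → ℝ := fun j => (x j : ℝ)

/-- The lattice simplex (as a subset of `ℝ^d`) with vertex family `v`. -/
def hullOf {d : ℕ} (v : Fin (d + 1) → Fin d → ℤ) : Set (Fin d → ℝ) :=
  convexHull ℝ (Set.range fun i => toR (v i))

/-- `v` is the vertex family of a `d`-dimensional canonical lattice simplex:
the vertices are affinely independent lattice points, the origin lies in the
interior, and the origin is the only lattice point in the interior. -/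
def IsCanonicalSimplex {d : ℕ} (v : Fin (d + 1) → Fin d → ℤ) : Prop :=
  AffineIndependent ℝ (fun i => toR (v i)) ∧
  (0 : Fin d → ℝ) ∈ interior (hullOf v) ∧
  ∀ x : Fin d → ℤ, toR x ∈ interior (hullOf v) → x = 0

/-- The multiplicity of the lattice simplex with vertex family `v`: the index in
`ℤ^d` of the subgroup generated by the vertices. -/
noncomputable def mult {d : ℕ} (v : Fin (d + 1) → Fin d → ℤ) : ℕ :=
  (AddSubgroup.closure (Set.range v)).index

/-- Two subsets of `ℝ^d` are unimodularly equivalent if one is the image of the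
other under `x ↦ A x + w` with `A ∈ GL_d(ℤ)` and `w ∈ ℤ^d`. -/
def UnimodEquiv {d : ℕ} (Q Q' : Set (Fin d → ℝ)) : Prop :=
  ∃ (A : Matrix (Fin d) (Fin d) ℤ) (w : Fin d → ℤ), IsUnit A.det ∧
    Q' = (fun x => (A.map fun n : ℤ => (n : ℝ)).mulVec x + toR w) '' Q

/-- The vertex family of the simplex
`conv{0, s_1 e_1, …, s_{d-2} e_{d-2}, 3(s_{d-1}-1) e_{d-1}, 3(s_{d-1}-1) e_d} - (1,…,1)`. -/
def mainV (d : ℕ) : Fin (d + 1) → Fin d → ℤ := fun i j =>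
  (if (j : ℕ) + 1 = (i : ℕ) then
      (if (i : ℕ) ≤ d - 2 then (sylv ((i : ℕ) - 1) : ℤ)
       else 3 * ((sylv (d - 2) : ℤ) - 1))
    else 0) - 1

section Sylvester

theorem two_le_sylv (i : ℕ) : 2 ≤ sylv i := by
  induction i with
  | zero => simp [sylv]
  | succ k ih =>
    simp only [sylv]
    have : 1 ≤ sylv k - 1 := by omega
    nlinarith

theorem cast_sylv_succ (i : ℕ) : (sylv (i + 1) : ℝ) = sylv i * (sylv i - 1) + 1 := by
  have := two_le_sylv i
  simp only [sylv]
  push_cast [Nat.cast_sub (by omega : 1 ≤ sylv i)]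
  ring

theorem two_le_cast_sylv (i : ℕ) : (2 : ℝ) ≤ sylv i := by exact_mod_cast two_le_sylv i

theorem cast_sylv_sub_one_pos (i : ℕ) : (0 : ℝ) < sylv i - 1 := by
  have := two_le_cast_sylv i
  linarith

theorem prod_sylv (n : ℕ) : ∏ i ∈ Finset.range n, (sylv i : ℝ) = sylv n - 1 := by
  induction n with
  | zero => simp [sylv]; norm_num
  | succ k ih => rw [Finset.prod_range_succ, ih, cast_sylv_succ]; ring

theorem sum_inv_sylv (n : ℕ) :
    ∑ i ∈ Finset.range n, (1 / sylv i : ℝ) = 1 - 1 / (sylv n - 1) := by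
  induction n with
  | zero => simp [sylv]; norm_num
  | succ k ih =>
    rw [Finset.sum_range_succ, ih, cast_sylv_succ]
    have h1 := cast_sylv_sub_one_pos k
    have h2 := two_le_cast_sylv k
    field_simp
    ring

theorem sylv_mono : Monotone sylv := by
  refine monotone_nat_of_le_succ fun n => ?_
  have := two_le_sylv n
  simp only [sylv]
  have : 1 ≤ sylv n - 1 := by omega
  nlinarith

end Sylvester

section Optimization

/-- Abel summation inequality. -/
theorem abel_sum_le {c u : ℕ → ℝ} (m : ℕ) (hc : ∀ i < m, c (i + 1) ≤ c i)
    (hu : ∀ l ≤ m, 0 ≤ ∑ i ∈ Finset.range l, u i) :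
    c m * ∑ i ∈ Finset.range (m + 1), u i ≤ ∑ i ∈ Finset.range (m + 1), c i * u i := by
  induction m with
  | zero => simp
  | succ k ih =>
    have h := ih (fun i hi => hc i (by omega)) (fun l hl => hu l (by omega))
    rw [Finset.sum_range_succ _ (k + 1), Finset.sum_range_succ _ (k + 1)]
    have h1 := hu (k + 1) le_rfl
    have h2 := hc k (by omega)
    nlinarith

theorem sum_le_of_prod_le {x a : ℕ → ℝ} (m : ℕ) (hx : ∀ i < m, 0 < x i) (ha : ∀ i < m, 0 < a i)
    (hanti : ∀ i, i + 1 < m → x (i + 1) ≤ x i)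
    (hprod : ∀ l ≤ m, ∏ i ∈ Finset.range l, x i ≤ ∏ i ∈ Finset.range l, a i) :
    ∑ i ∈ Finset.range m, x i ≤ ∑ i ∈ Finset.range m, a i := by
  obtain _ | m := m
  · simp
  have hlog : ∀ l ≤ m + 1, 0 ≤ ∑ i ∈ Finset.range l, Real.log (a i / x i) := by
    intro l hl
    have hx' : ∀ i ∈ Finset.range l, 0 < x i := fun i hi => hx i (by simp at hi; omega)
    have ha' : ∀ i ∈ Finset.range l, 0 < a i := fun i hi => ha i (by simp at hi; omega)
    rw [← Real.log_prod (fun i hi => (div_pos (ha' i hi) (hx' i hi)).ne'), Finset.prod_div_distrib]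
    apply Real.log_nonneg
    rw [one_le_div (Finset.prod_pos hx')]
    exact hprod l hl
  have h := abel_sum_le (c := x) (u := fun i => Real.log (a i / x i)) m
    (fun i hi => hanti i (by omega)) (fun l hl => hlog l (by omega))
  have h1 : 0 ≤ ∑ i ∈ Finset.range (m + 1), x i * Real.log (a i / x i) :=
    le_trans (mul_nonneg (hx m (by omega)).le (hlog _ le_rfl)) h
  have h2 : ∑ i ∈ Finset.range (m + 1), x i * Real.log (a i / x i)
      ≤ ∑ i ∈ Finset.range (m + 1), (a i - x i) := by
    refine Finset.sum_le_sum fun i hi => ?_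
    have hxi := hx i (by simpa using hi)
    have := Real.log_le_sub_one_of_pos (div_pos (ha i (by simpa using hi)) hxi)
    calc x i * Real.log (a i / x i) ≤ x i * (a i / x i - 1) := by gcongr
      _ = a i - x i := by field_simp
  rw [Finset.sum_sub_distrib] at h2
  linarith

theorem sum_le_of_prod_le_sub {n : ℕ} {x : ℕ → ℝ} (hpos : ∀ i ≤ n, 0 < x i)
    (hanti : ∀ i < n, x (i + 1) ≤ x i)
    (hps : ∀ j ≤ n, ∏ i ∈ Finset.range j, x i ≤ 1 - ∑ i ∈ Finset.range j, x i)
    {j : ℕ} (hj : j ≤ n) :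
    ∑ i ∈ Finset.range j, x i ≤ 1 - 1 / ((sylv j : ℝ) - 1) := by
  classical
  let p : ℕ → Prop := fun k => 1 / ((sylv k : ℝ) - 1) ≤ ∏ i ∈ Finset.range k, x i
  have hp0 : p 0 := by simp [p, sylv]; norm_num
  obtain ⟨k, hk⟩ : ∃ k, k = Nat.findGreatest p j := ⟨_, rfl⟩
  have hkj : k ≤ j := hk ▸ Nat.findGreatest_le j
  have hpk : p k := hk ▸ Nat.findGreatest_spec (m := 0) (Nat.zero_le j) hp0
  have hsum : ∑ i ∈ Finset.range k, x i ≤ 1 - 1 / ((sylv k : ℝ) - 1) := by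
    have := hps k (by omega)
    simp only [p] at hpk
    linarith
  obtain ⟨m, rfl⟩ := Nat.exists_eq_add_of_le hkj
  have hS : ∀ i, (0 : ℝ) < 1 / ((sylv i : ℝ) - 1) :=
    fun i => one_div_pos.2 (cast_sylv_sub_one_pos i)
  have h := sum_le_of_prod_le (x := fun i => x (k + i)) (a := fun i => (1 / sylv (k + i) : ℝ)) m
    (fun i hi => hpos _ (by omega))
    (fun i hi => one_div_pos.2 (by linarith [two_le_cast_sylv (k + i)]))
    (fun i hi => hanti (k + i) (by omega)) ?_
  · rw [Finset.sum_range_add]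
    have h2 := sum_inv_sylv (k + m)
    rw [Finset.sum_range_add, sum_inv_sylv k] at h2
    linarith
  · intro l hl
    obtain rfl | hl0 := Nat.eq_zero_or_pos l
    · simp
    have hnot : ¬ p (k + l) := Nat.findGreatest_is_greatest (n := k + m)
      (by rw [← hk]; omega) (by omega)
    simp only [p, not_le] at hnot
    rw [Finset.prod_range_add] at hnot
    have hprod : ∏ i ∈ Finset.range (k + l), (1 / sylv i : ℝ) = 1 / ((sylv (k + l) : ℝ) - 1) := by
      rw [Finset.prod_div_distrib, prod_sylv]; simp
    have hprodk : ∏ i ∈ Finset.range k, (1 / sylv i : ℝ) = 1 / ((sylv k : ℝ) - 1) := by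
      rw [Finset.prod_div_distrib, prod_sylv]; simp
    rw [Finset.prod_range_add, hprodk] at hprod
    rw [← hprod] at hnot
    have hnn : 0 ≤ ∏ i ∈ Finset.range l, x (k + i) :=
      Finset.prod_nonneg fun i hi => (hpos _ (by simp at hi; omega)).le
    have : 1 / ((sylv k : ℝ) - 1) * ∏ i ∈ Finset.range l, x (k + i)
        ≤ 1 / ((sylv k : ℝ) - 1) * ∏ i ∈ Finset.range l, (1 / sylv (k + i) : ℝ) :=
      (mul_le_mul_of_nonneg_right hpk hnn).trans hnot.le
    exact le_of_mul_le_mul_left this (hS k)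

theorem four_prod_gt {p t q y : ℝ} (hy : 1 / 36 < y) (hqy : y ≤ q) (hqt : q ≤ t) (htp : t ≤ p)
    (hp : p ≤ 1 / 2) (hpt : p + t ≤ 5 / 6) (hptq : p + t + q ≤ 1)
    (hsum : 1 ≤ p + t + q + 3 * y) :
    1 / 5292 < p * t * q * y := by
  have hy0 : 0 < y := by linarith
  obtain h1 | h1 := le_total y (1 / 24)
  · have h2 : 1 / 2 * (p + t - 1 / 2) ≤ p * t := by
      nlinarith [mul_nonneg (sub_nonneg.2 hp) (sub_nonneg.2 (htp.trans hp))]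
    have h3 : 1 / 18 - y ≤ (p + t - 1 / 2) * q := by
      nlinarith [mul_nonneg (sub_nonneg.2 hpt) (by linarith : 0 ≤ 1 / 3 - q)]
    have h4 : 1 / 2 * (1 / 18 - y) ≤ p * t * q := by nlinarith
    have h5 : 1 / 2 * (1 / 18 - y) * y ≤ p * t * q * y := by gcongr
    nlinarith
  have h2 : y * (t + q - y) ≤ t * q := by nlinarith
  have hp0 : 0 < p := by linarith
  have hq0 : 0 < q := by linarith
  have ht0 : 0 < t := by linarith
  obtain h5 | h5 := le_total (1 / 2) (t + q - y)
  · have h6 : 1 / 4 ≤ p := by linarith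
    have h7 : 1 / 4 * (1 / 24 * (1 / 2)) * (1 / 24) ≤ p * (y * (t + q - y)) * y := by gcongr
    have h8 : p * (y * (t + q - y)) * y ≤ p * (t * q) * y := by gcongr
    nlinarith
  obtain h3 | h3 := le_total y (1 / 10)
  · have h4 : 1 / 2 * (1 / 2 - 4 * y) ≤ p * (t + q - y) := by
      nlinarith [mul_nonneg (sub_nonneg.2 hp) (sub_nonneg.2 h5)]
    have h5 : 1 / 2 * (1 / 2 - 4 * y) * y ≤ p * (t * q) := by
      calc _ ≤ p * (t + q - y) * y := by gcongr
        _ = p * (y * (t + q - y)) := by ring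
        _ ≤ _ := by gcongr
    have h6 : 1 / 2 * (1 / 2 - 4 * y) * y * y ≤ p * (t * q) * y := by gcongr
    have h7 : 0 ≤ (y - 1 / 24) * (1 / 10 - y) := mul_nonneg (by linarith) (by linarith)
    nlinarith
  obtain h7 | h7 := le_or_gt (1 / 6) y
  · have h4 : (1 / 6 : ℝ) * (1 / 6) * (1 / 6) * (1 / 6) ≤ p * t * q * y := by
      gcongr <;> linarith
    linarith
  · have h4 : (1 - 5 * y) * y ≤ p * (t + q - y) := by nlinarith
    have h5 : (1 - 5 * y) * y * y ≤ p * (t * q) := by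
      calc _ ≤ p * (t + q - y) * y := by gcongr
        _ = p * (y * (t + q - y)) := by ring
        _ ≤ _ := by gcongr
    have h6 : (1 - 5 * y) * y * y * y ≤ p * (t * q) * y := by gcongr
    have h8 : 1 / 100 ≤ y * y := by nlinarith
    have h9 : 1 / 60 ≤ (1 - 5 * y) * y := by nlinarith
    have h10 : 1 / 60 * (1 / 100) ≤ ((1 - 5 * y) * y) * (y * y) := by
      gcongr
    have : 1 / 6000 ≤ p * (t * q) * y := by linarith
    nlinarith

/-- The numerical core: among decreasing sequences subject to the product-sum inequalities, the
product `x 0 * ⋯ * x n` is smallest exactly for the truncated Sylvester sequence. -/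
theorem eq_sylvester_of_prod_le {n : ℕ} (hn : 3 ≤ n) {x : ℕ → ℝ} (hpos : ∀ i ≤ n, 0 < x i)
    (hanti : ∀ i < n, x (i + 1) ≤ x i)
    (hps : ∀ j ≤ n, ∏ i ∈ Finset.range j, x i ≤ 1 - ∑ i ∈ Finset.range j, x i)
    (hsum : 1 ≤ ∑ i ∈ Finset.range n, x i + 3 * x n)
    (hW : (∏ i ∈ Finset.range n, x i) * x n * (3 * ((sylv n : ℝ) - 1) ^ 2) ≤ 1) :
    (∀ i < n, x i = 1 / sylv i) ∧ x n = 1 / (3 * ((sylv n : ℝ) - 1)) := by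
  have hA := fun {j : ℕ} (hj : j ≤ n) => sum_le_of_prod_le_sub hpos hanti hps hj
  set S : ℝ := (sylv n : ℝ) - 1 with hS
  have hS0 : 0 < S := cast_sylv_sub_one_pos n
  obtain ⟨r, hr⟩ : ∃ r, r = 3 * S * x n := ⟨_, rfl⟩
  have hxn : 3 * x n = r / S := by rw [hr]; field_simp
  have hr1 : 1 ≤ r := by
    have := hA le_rfl
    have h : 1 / S ≤ r / S := by rw [← hxn]; linarith
    rwa [div_le_div_iff_of_pos_right hS0] at h
  have hs0 : ∀ i, (0 : ℝ) < sylv i := fun i => by linarith [two_le_cast_sylv i]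
  have hlogs : ∑ i ∈ Finset.range n, Real.log (x i * sylv i) + Real.log r ≤ 0 := by
    have hx' : ∀ i ∈ Finset.range n, 0 < x i * sylv i :=
      fun i hi => mul_pos (hpos i (by simp at hi; omega)) (hs0 i)
    rw [← Real.log_prod (fun i hi => (hx' i hi).ne'),
      ← Real.log_mul (Finset.prod_pos hx').ne' (by linarith)]
    apply Real.log_nonpos (mul_nonneg (Finset.prod_pos hx').le (by linarith))
    rw [Finset.prod_mul_distrib, prod_sylv, ← hS, hr]
    calc _ = (∏ i ∈ Finset.range n, x i) * x n * (3 * S ^ 2) := by ring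
      _ ≤ 1 := hW
  have hterm : ∀ i < n, (x i - 1 / sylv i) / x i ≤ Real.log (x i * sylv i) := by
    intro i hi
    have hxi := hpos i hi.le
    have h := Real.one_sub_inv_le_log_of_pos (mul_pos hxi (hs0 i))
    have h' := hs0 i
    convert h using 1
    field_simp
  obtain ⟨m, rfl⟩ : ∃ m, n = m + 1 := ⟨n - 1, by omega⟩
  have habel : (1 - r) / (S * x m) ≤
      ∑ i ∈ Finset.range (m + 1), (x i - 1 / sylv i) / x i := by
    have h := abel_sum_le (c := fun i => -(1 / x i)) (u := fun i => 1 / sylv i - x i) m ?_ ?_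
    · have h1 : ∑ i ∈ Finset.range (m + 1), -(1 / x i) * (1 / sylv i - x i)
          = ∑ i ∈ Finset.range (m + 1), (x i - 1 / sylv i) / x i := by
        refine Finset.sum_congr rfl fun i hi => ?_
        have hxi := hpos i (by simp at hi; omega)
        have h' := hs0 i
        field_simp
        ring
      rw [h1, Finset.sum_sub_distrib, sum_inv_sylv, ← hS] at h
      refine le_trans ?_ h
      have hxm := hpos m (by omega)
      have h2 : 1 - 1 / S - ∑ i ∈ Finset.range (m + 1), x i ≤ (r - 1) / S := by
        rw [sub_div, ← hxn]
        linarith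
      calc (1 - r) / (S * x m) = -(1 / x m) * ((r - 1) / S) := by field_simp; ring
        _ ≤ _ := mul_le_mul_of_nonpos_left h2 (by simp [hxm.le])
    · intro i hi
      have := one_div_le_one_div_of_le (hpos (i + 1) (by omega)) (hanti i (by omega))
      simpa using this
    · intro l hl
      rw [Finset.sum_sub_distrib, sum_inv_sylv]
      have := hA (j := l) (by omega)
      linarith
  have hlogr : 0 ≤ Real.log r := Real.log_nonneg hr1
  have hlog_le : ∑ i ∈ Finset.range (m + 1), (x i - 1 / sylv i) / x i + Real.log r ≤ 0 :=
    le_trans (add_le_add_left (Finset.sum_le_sum fun i hi => hterm i (by simpa using hi)) _) hlogs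
  have hxm := hpos m (by omega)
  have hX1 : r / 3 ≤ S * x m := by
    have := hanti m (by omega)
    rw [hr]
    nlinarith
  have hSm : S = ((sylv m : ℝ) - 1) * sylv m := by rw [hS, cast_sylv_succ]; ring
  have hX2 : sylv m - r ≤ S * x m := by
    have h1 := hA (j := m) (by omega)
    rw [Finset.sum_range_succ] at hsum
    have h2 : 1 / ((sylv m : ℝ) - 1) - r / S ≤ x m := by rw [← hxn]; linarith
    have h3 := cast_sylv_sub_one_pos m
    have h4 := hs0 m
    calc (sylv m : ℝ) - r = S * (1 / ((sylv m : ℝ) - 1) - r / S) := by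
          rw [hSm]; field_simp
      _ ≤ _ := by gcongr
  have hXlog : S * x m * Real.log r ≤ r - 1 := by
    have hX0 : 0 < S * x m := mul_pos hS0 hxm
    have h1 : Real.log r ≤ (r - 1) / (S * x m) := by
      have : (1 - r) / (S * x m) = - ((r - 1) / (S * x m)) := by ring
      linarith
    rw [le_div_iff₀ hX0] at h1
    linarith
  have hr_eq : r = 1 := by
    by_contra hne
    have hr1' : 1 < r := lt_of_le_of_ne hr1 (Ne.symm hne)
    have key : ∀ c : ℝ, r ≤ c → 2 * c ≤ sylv m → False := by
      intro c hc hcm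
      have h1 : r ≤ S * x m := by linarith
      have h2 : 1 - r⁻¹ < Real.log r := by
        have h := Real.log_lt_sub_one_of_pos (inv_pos.2 (by linarith : 0 < r))
          (by simpa using hne)
        rw [Real.log_inv] at h
        linarith
      have h3 : r * (1 - r⁻¹) < r * Real.log r := by gcongr
      have h4 : r * (1 - r⁻¹) = r - 1 := by field_simp
      nlinarith
    obtain hm | hm := Nat.lt_or_ge m 3
    · obtain rfl : m = 2 := by omega
      have hs2 : (sylv 2 : ℝ) = 7 := by norm_num [sylv]
      have hs3 : (sylv 3 : ℝ) = 43 := by norm_num [sylv]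
      obtain h | h := le_or_gt r (7 / 2)
      · exact key (7 / 2) h (by rw [hs2]; norm_num)
      · have hS42 : S = 42 := by rw [hS]; norm_num [hs3]
        have h1 := hA (j := 1) (by omega)
        have h2 := hA (j := 2) (by omega)
        have h3 := hA (j := 3) (by omega)
        norm_num [Finset.sum_range_succ, sylv] at h1 h2 h3
        norm_num [Finset.sum_range_succ] at hsum
        norm_num [Finset.prod_range_succ, hS42] at hW
        rw [hS42] at hr
        have := four_prod_gt (p := x 0) (t := x 1) (q := x 2) (y := x 3) (by linarith)
          (hanti 2 (by omega)) (hanti 1 (by omega)) (hanti 0 (by omega)) (by linarith)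
          (by linarith) (by linarith) (by linarith)
        linarith
    · have hs3 : (43 : ℝ) ≤ sylv m := by
        have : sylv 3 ≤ sylv m := sylv_mono hm
        have h3 : sylv 3 = 43 := by norm_num [sylv]
        rw [h3] at this
        exact_mod_cast this
      obtain h | h := le_or_gt r (43 / 2)
      · exact key (43 / 2) h (by linarith)
      · have hexp : Real.exp 3 ≤ r := by
          have he : Real.exp 3 = Real.exp 1 ^ 3 := by rw [← Real.exp_nat_mul]; norm_num
          have h1 := Real.exp_one_lt_d9
          have h2 : Real.exp 1 ^ 3 ≤ (2.75 : ℝ) ^ 3 := by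
            gcongr
            linarith
          rw [he]
          norm_num at h2
          linarith
        have h3 : 3 ≤ Real.log r := (Real.le_log_iff_exp_le (by linarith)).2 hexp
        nlinarith
  have hlog0 : ∑ i ∈ Finset.range (m + 1), Real.log (x i * sylv i) ≤ 0 := by
    rw [hr_eq] at hlogs; simpa using hlogs
  have habel0 : 0 ≤ ∑ i ∈ Finset.range (m + 1), (x i - 1 / sylv i) / x i := by
    rw [hr_eq] at habel; simpa using habel
  refine ⟨fun i hi => ?_, ?_⟩
  · have heq : ∀ i ∈ Finset.range (m + 1),
        (x i - 1 / sylv i) / x i = Real.log (x i * sylv i) := by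
      rw [← Finset.sum_eq_sum_iff_of_le fun i hi => hterm i (by simpa using hi)]
      refine le_antisymm (Finset.sum_le_sum fun i hi => hterm i (by simpa using hi)) ?_
      linarith
    have h := heq i (by simpa using hi)
    have hxi := hpos i hi.le
    have hsi := hs0 i
    by_contra hne
    have hne' : (x i * sylv i)⁻¹ ≠ 1 := by
      intro h1
      rw [inv_eq_one] at h1
      exact hne (by field_simp; exact h1)
    have h2 := Real.log_lt_sub_one_of_pos (inv_pos.2 (mul_pos hxi hsi)) hne'
    rw [Real.log_inv] at h2
    have h3 : (x i - 1 / sylv i) / x i = 1 - (x i * sylv i)⁻¹ := by field_simp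
    linarith
  · rw [hr_eq] at hr
    rw [eq_div_iff (by positivity)]
    linarith

end Optimization

section Barycentric

/-- The linear parts `T` and the values at the origin `β` of the barycentric coordinates of a
canonical simplex with vertex family `v`. -/
structure IsBarycentric {d : ℕ} (v : Fin (d + 1) → Fin d → ℤ)
    (T : Fin (d + 1) → (Fin d → ℝ) →ₗ[ℝ] ℝ) (β : Fin (d + 1) → ℝ) : Prop where
  pos : ∀ i, 0 < β i
  sum_weight : ∑ i, β i = 1
  apply_vertex : ∀ i j, T i (toR (v j)) = (if i = j then 1 else 0) - β i
  sum_apply : ∀ x, ∑ i, T i x = 0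
  ext_zero : ∀ x, (∀ i, T i x = 0) → x = 0
  eq_zero : ∀ x : Fin d → ℤ, (∀ i, -β i < T i (toR x)) → x = 0

variable {d : ℕ} {v : Fin (d + 1) → Fin d → ℤ} {T : Fin (d + 1) → (Fin d → ℝ) →ₗ[ℝ] ℝ}
  {β : Fin (d + 1) → ℝ}

/-- An affinely independent family of `d + 1` points of `ℝ^d` as an affine basis. -/
noncomputable def simplexBasis {p : Fin (d + 1) → Fin d → ℝ} (hp : AffineIndependent ℝ p) :
    AffineBasis (Fin (d + 1)) ℝ (Fin d → ℝ) :=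
  ⟨p, hp, hp.affineSpan_eq_top_iff_card_eq_finrank_add_one.2 (by simp)⟩

theorem interior_convexHull_range {p : Fin (d + 1) → Fin d → ℝ} (hp : AffineIndependent ℝ p) :
    interior (convexHull ℝ (Set.range p)) = {x | ∀ i, 0 < (simplexBasis hp).coord i x} :=
  (simplexBasis hp).interior_convexHull

theorem IsCanonicalSimplex.exists_isBarycentric (hv : IsCanonicalSimplex v) :
    ∃ T β, IsBarycentric v T β := by
  obtain ⟨hind, h0, hint⟩ := hv
  unfold hullOf at h0 hint
  rw [interior_convexHull_range hind] at h0 hint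
  set b := simplexBasis hind
  have hdec : ∀ i x, b.coord i x = (b.coord i).linear x + b.coord i 0 := fun i x => by
    have := (b.coord i).map_vadd 0 x
    simpa using this
  refine ⟨fun i => (b.coord i).linear, fun i => b.coord i 0, h0, b.sum_coord_apply_eq_one 0,
    fun i j => ?_, fun x => ?_, fun x hx => ?_, fun x hx => hint x fun i => ?_⟩
  · have := b.coord_apply i j
    rw [hdec] at this
    change (b.coord i).linear (b j) = _
    linarith
  · have h1 := b.sum_coord_apply_eq_one x
    simp_rw [hdec _ x, Finset.sum_add_distrib, b.sum_coord_apply_eq_one 0] at h1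
    linarith
  · refine b.ext_elem fun i => ?_
    rw [hdec, hx, zero_add]
  · have := hx i
    rw [hdec]
    linarith

theorem IsBarycentric.perm (h : IsBarycentric v T β) (σ : Equiv.Perm (Fin (d + 1))) :
    IsBarycentric (v ∘ σ) (T ∘ σ) (β ∘ σ) where
  pos i := h.pos _
  sum_weight := (Equiv.sum_comp σ β).trans h.sum_weight
  apply_vertex i j := by simp [h.apply_vertex]
  sum_apply x := (Equiv.sum_comp σ fun i => T i x).trans (h.sum_apply x)
  ext_zero x hx := h.ext_zero x fun i => by simpa using hx (σ.symm i)
  eq_zero x hx := h.eq_zero x fun i => by simpa using hx (σ.symm i)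

theorem toR_add (x y : Fin d → ℤ) : toR (x + y) = toR x + toR y := by ext; simp [toR]

theorem toR_sub (x y : Fin d → ℤ) : toR (x - y) = toR x - toR y := by ext; simp [toR]

theorem toR_neg (x : Fin d → ℤ) : toR (-x) = -toR x := by ext; simp [toR]

theorem toR_zsmul (n : ℤ) (x : Fin d → ℤ) : toR (n • x) = (n : ℝ) • toR x := by ext; simp [toR]

theorem toR_sum {ι : Type*} (s : Finset ι) (f : ι → Fin d → ℤ) :
    toR (∑ i ∈ s, f i) = ∑ i ∈ s, toR (f i) := by ext; simp [toR]

theorem toR_injective : Function.Injective (toR (d := d)) := fun x y h => by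
  ext i
  have := congrFun h i
  simpa [toR] using this

theorem IsBarycentric.apply_sum (h : IsBarycentric v T β) (n : Fin (d + 1) → ℝ) (i) :
    T i (∑ j, n j • toR (v j)) = n i - (∑ j, n j) * β i := by
  simp [map_sum, h.apply_vertex, mul_sub, Finset.sum_sub_distrib, Finset.sum_mul]

end Barycentric

section LinearForms

open MeasureTheory in
/-- Minkowski's theorem on linear forms. -/
theorem exists_int_ne_zero_abs_mulVec_lt {ι : Type*} [Fintype ι] [DecidableEq ι]
    (M : Matrix ι ι ℝ) (hM : M.det ≠ 0) (r : ι → ℝ) (hr : ∀ i, 0 < r i)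
    (hlt : |M.det| < ∏ i, r i) :
    ∃ x : ι → ℤ, x ≠ 0 ∧ ∀ i, |M.mulVec (fun j => (x j : ℝ)) i| < r i := by
  have hM' : LinearMap.det (Matrix.toLin' M) ≠ 0 := by rwa [LinearMap.det_toLin']
  have hpi : ∀ y : ι → ℝ, y ∈ Set.pi Set.univ (fun i => Set.Ioo (-r i) (r i)) ↔
      ∀ i, |y i| < r i := fun y => by simp [abs_lt]
  have : Countable (Submodule.span ℤ (Set.range (Pi.basisFun ℝ ι))).toAddSubgroup :=
    inferInstanceAs (Countable (Submodule.span ℤ (Set.range (Pi.basisFun ℝ ι))))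
  have key := exists_ne_zero_mem_lattice_of_measure_mul_two_pow_lt_measure
    (μ := volume) (s := Matrix.toLin' M ⁻¹' Set.pi Set.univ (fun i => Set.Ioo (-r i) (r i)))
    (ZSpan.isAddFundamentalDomain' (Pi.basisFun ℝ ι) volume) ?_ ?_ ?_
  · obtain ⟨⟨y, hyL⟩, hy0, hy⟩ := key
    have hy' := ((Pi.basisFun ℝ ι).mem_span_iff_repr_mem ℤ y).1 hyL
    choose x hx using hy'
    have hxy : (fun j => (x j : ℝ)) = y := funext fun j => by simpa using hx j
    refine ⟨x, fun h0 => hy0 ?_, fun i => ?_⟩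
    · subst h0
      ext j
      simp [← hxy]
    · rw [hxy]
      exact (hpi _).1 hy i
  · intro x hx
    rw [Set.mem_preimage, hpi] at hx ⊢
    simpa [Matrix.mulVec_neg] using hx
  · exact (convex_pi fun i _ => convex_Ioo _ _).linear_preimage _
  · rw [Measure.addHaar_preimage_linearMap _ hM', LinearMap.det_toLin',
      ZSpan.volume_fundamentalDomain, volume_pi, Measure.pi_pi]
    simp_rw [Real.volume_Ioo]
    rw [← ENNReal.ofReal_prod_of_nonneg fun i _ => by linarith [hr i],
      ← ENNReal.ofReal_mul (abs_nonneg _), Module.finrank_fintype_fun_eq_card,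
      show (2 : ENNReal) = ENNReal.ofReal 2 by simp, ← ENNReal.ofReal_pow zero_le_two,
      ← ENNReal.ofReal_mul (abs_nonneg _)]
    have h1 : Matrix.of (Pi.basisFun ℝ ι) = (1 : Matrix ι ι ℝ) := by
      ext i j
      simp [Pi.single_apply, Matrix.one_apply, eq_comm]
    have h2 : ∏ i, (r i - -r i) = 2 ^ Fintype.card ι * ∏ i, r i := by
      rw [← Finset.card_univ, ← Finset.prod_const, ← Finset.prod_mul_distrib]
      exact Finset.prod_congr rfl fun i _ => by ring
    rw [h1, h2, Matrix.det_one, abs_one, one_mul, abs_inv,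
      ENNReal.ofReal_lt_ofReal_iff_of_nonneg (by positivity)]
    have h3 : 0 < |M.det| := abs_pos.2 hM
    rw [inv_mul_eq_div, lt_div_iff₀ h3]
    gcongr

theorem index_closure_range {ι : Type*} [Fintype ι] [DecidableEq ι] (V : Matrix ι ι ℤ)
    (hV : V.det ≠ 0) : (AddSubgroup.closure (Set.range V.row)).index = V.det.natAbs := by
  have hli : LinearIndependent ℤ V.row := Matrix.linearIndependent_rows_of_det_ne_zero hV
  have hcl : AddSubgroup.closure (Set.range V.row) =
      (Submodule.span ℤ (Set.range V.row)).toAddSubgroup :=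
    (Submodule.span_int_eq_addSubgroupClosure _).symm
  rw [hcl, AddSubgroup.index_eq_natAbs_det (Pi.basisFun ℤ ι) _ (Module.Basis.span hli)]
  have : (fun i => ((Module.Basis.span hli i : Submodule.span ℤ (Set.range V.row)) : ι → ℤ))
      = V.row := funext fun i => by rw [Module.Basis.span_apply]
  change ((Pi.basisFun ℤ ι).det
    (fun i => ((Module.Basis.span hli i : Submodule.span ℤ (Set.range V.row)) : ι → ℤ))).natAbs = _
  rw [this, Pi.basisFun_det_apply]
  rfl

end LinearForms

section VolumeBounds

variable {d : ℕ} {v : Fin (d + 1) → Fin d → ℤ} {T : Fin (d + 1) → (Fin d → ℝ) →ₗ[ℝ] ℝ}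
  {β : Fin (d + 1) → ℝ}

theorem det_one_sub_vecMulVec {ι : Type*} [Fintype ι] [DecidableEq ι] (b c : ι → ℝ) :
    (1 - Matrix.vecMulVec b c).det = 1 - ∑ i, b i * c i := by
  rw [Matrix.vecMulVec_eq Unit, Matrix.det_one_sub_mul_comm, Matrix.det_unique]
  simp [Matrix.mul_apply, mul_comm]

theorem IsBarycentric.eq_zero_of_abs_lt (h : IsBarycentric v T β) (k : Fin (d + 1))
    {x : Fin d → ℤ} (hx : ∀ i, i ≠ k → |T i (toR x)| < β i) : x = 0 := by
  obtain hk | hk := le_total 0 (T k (toR x))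
  · refine h.eq_zero x fun i => ?_
    obtain rfl | hi := eq_or_ne i k
    · linarith [h.pos i]
    · exact (abs_lt.1 (hx i hi)).1
  · refine neg_eq_zero.1 (h.eq_zero (-x) fun i => ?_)
    rw [toR_neg, map_neg]
    obtain rfl | hi := eq_or_ne i k
    · linarith [h.pos i]
    · linarith [(abs_lt.1 (hx i hi)).2]

theorem IsBarycentric.prod_le (h : IsBarycentric v T β) {s : Finset (Fin (d + 1))}
    {k : Fin (d + 1)} (hk : k ∉ s) : ∏ i ∈ s, β i ≤ 1 - ∑ i ∈ s, β i := by
  by_contra! hlt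
  have hpos : 0 < 1 - ∑ i ∈ s, β i := by
    rw [← h.sum_weight, sub_pos]
    exact Finset.sum_lt_sum_of_subset (Finset.subset_univ s) (Finset.mem_univ k) hk (h.pos k)
      fun i _ _ => (h.pos i).le
  set M : Matrix s s ℝ := 1 - Matrix.vecMulVec (fun i : s => β i) (fun _ => 1) with hM
  have hdet : M.det = 1 - ∑ i ∈ s, β i := by
    rw [det_one_sub_vecMulVec, ← Finset.sum_coe_sort s]
    simp
  obtain ⟨n, hn0, hn⟩ := exists_int_ne_zero_abs_mulVec_lt M (by rw [hdet]; exact hpos.ne')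
    (fun i => β i) (fun i => h.pos i) (by
      rw [hdet, abs_of_pos hpos]
      rwa [← Finset.prod_coe_sort s] at hlt)
  have hn' : ∀ i : s, |(n i : ℝ) - (∑ j, (n j : ℝ)) * β i| < β i := by
    intro i
    convert hn i using 2
    simp [hM, Matrix.sub_mulVec, Matrix.vecMulVec_mulVec, dotProduct, mul_comm]
  clear_value M
  have main : ∀ n : s → ℤ, n ≠ 0 → (∀ i : s, |(n i : ℝ) - (∑ j, (n j : ℝ)) * β i| < β i) →
      ∑ j, (n j : ℝ) ≤ 0 → False := by
    intro n hn0 hn hsum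
    let N : Fin (d + 1) → ℤ := fun i => if hi : i ∈ s then n ⟨i, hi⟩ else 0
    have hNs : ∑ i, (N i : ℝ) = ∑ j, (n j : ℝ) := by
      rw [← Finset.sum_subset (Finset.subset_univ s) (fun i _ hi => by simp [N, hi]),
        ← Finset.sum_coe_sort s]
      exact Finset.sum_congr rfl fun i _ => by simp [N]
    have hT : ∀ i, T i (toR (∑ j, N j • v j)) = N i - (∑ j, (n j : ℝ)) * β i := by
      intro i
      simp_rw [toR_sum, toR_zsmul]
      rw [h.apply_sum, hNs]
    have hx : ∑ j, N j • v j = 0 := by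
      refine h.eq_zero _ fun i => ?_
      rw [hT]
      by_cases hi : i ∈ s
      · have := (abs_lt.1 (hn ⟨i, hi⟩)).1
        simpa [N, hi] using this
      · have := h.pos i
        simp only [N, hi, dite_false, Int.cast_zero]
        nlinarith
    have hzero : toR (0 : Fin d → ℤ) = 0 := by ext; simp [toR]
    have hk0 := hT k
    rw [hx, hzero, map_zero] at hk0
    simp only [N, hk, dite_false, Int.cast_zero, zero_sub, zero_eq_neg, mul_eq_zero,
      (h.pos k).ne', or_false] at hk0
    refine hn0 (funext fun i => ?_)
    have hi := hT i
    rw [hx, hzero, map_zero, hk0] at hi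
    have hi' : (n i : ℝ) = 0 := by simpa [N] using hi.symm
    exact_mod_cast hi'
  obtain hle | hle := le_total (∑ j, (n j : ℝ)) 0
  · exact main n hn0 hn' hle
  · refine main (-n) (neg_ne_zero.2 hn0) (fun i => ?_) (by simpa using hle)
    rw [← abs_neg]
    convert hn' i using 2
    simp
    ring

/-- The matrix of all but the last linear form. -/
def coordMatrix (T : Fin (d + 1) → (Fin d → ℝ) →ₗ[ℝ] ℝ) : Matrix (Fin d) (Fin d) ℝ :=
  Matrix.of fun i j => T i.castSucc (Pi.single j 1)

theorem coordMatrix_mulVec (x : Fin d → ℝ) (i : Fin d) :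
    (coordMatrix T).mulVec x i = T i.castSucc x := by
  conv_rhs => rw [← Finset.univ_sum_single x, map_sum]
  simp only [Matrix.mulVec, dotProduct, coordMatrix, Matrix.of_apply]
  refine Finset.sum_congr rfl fun j _ => ?_
  have : Pi.single j (x j) = x j • (Pi.single j 1 : Fin d → ℝ) := by
    ext l
    simp [Pi.single_apply]
  rw [this, map_smul, smul_eq_mul, mul_comm]

/-- The matrix whose rows are all but the last vertex. -/
def vertexMatrix (v : Fin (d + 1) → Fin d → ℤ) : Matrix (Fin d) (Fin d) ℤ :=
  Matrix.of fun i => v i.castSucc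

theorem IsBarycentric.det_mul_det (h : IsBarycentric v T β) :
    (coordMatrix T).det * (vertexMatrix v).det = β (Fin.last d) := by
  have h1 : coordMatrix T * ((vertexMatrix v).map ((↑) : ℤ → ℝ)).transpose =
      1 - Matrix.vecMulVec (fun i => β i.castSucc) (fun _ => 1) := by
    ext i j
    have h2 : (coordMatrix T * ((vertexMatrix v).map ((↑) : ℤ → ℝ)).transpose) i j =
        (coordMatrix T).mulVec (toR (v j.castSucc)) i := rfl
    rw [h2, coordMatrix_mulVec, h.apply_vertex]
    simp [Matrix.vecMulVec_apply, Matrix.one_apply]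
  have h2 := congrArg Matrix.det h1
  rw [Matrix.det_mul, Matrix.det_transpose, det_one_sub_vecMulVec] at h2
  have h3 : ((vertexMatrix v).map ((↑) : ℤ → ℝ)).det = ((vertexMatrix v).det : ℝ) :=
    (Int.cast_det _).symm
  rw [h3] at h2
  rw [h2]
  have h4 := h.sum_weight
  rw [Fin.sum_univ_castSucc] at h4
  simp
  linarith

theorem IsBarycentric.det_coordMatrix_ne_zero (h : IsBarycentric v T β) :
    (coordMatrix T).det ≠ 0 := fun h0 => by
  have := h.det_mul_det
  rw [h0, zero_mul] at this
  exact (h.pos _).ne this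

theorem IsBarycentric.prod_le_abs_det (h : IsBarycentric v T β) :
    ∏ i : Fin d, β i.castSucc ≤ |(coordMatrix T).det| := by
  by_contra! hlt
  obtain ⟨x, hx0, hx⟩ := exists_int_ne_zero_abs_mulVec_lt _ h.det_coordMatrix_ne_zero
    (fun i => β i.castSucc) (fun i => h.pos _) hlt
  refine hx0 (h.eq_zero_of_abs_lt (Fin.last d) fun i hi => ?_)
  obtain ⟨j, rfl⟩ := Fin.exists_castSucc_eq.2 hi
  have := hx j
  rwa [coordMatrix_mulVec] at this

theorem IsBarycentric.mult_dvd (h : IsBarycentric v T β) :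
    (vertexMatrix v).det ≠ 0 ∧ mult v ∣ (vertexMatrix v).det.natAbs := by
  have h0 : (vertexMatrix v).det ≠ 0 := fun h0 => by
    have := h.det_mul_det
    rw [h0, Int.cast_zero, mul_zero] at this
    exact (h.pos _).ne this
  refine ⟨h0, ?_⟩
  rw [← index_closure_range _ h0]
  refine AddSubgroup.index_dvd_of_le (AddSubgroup.closure_mono ?_)
  rintro _ ⟨i, rfl⟩
  exact ⟨i.castSucc, rfl⟩

theorem IsBarycentric.mult_pos (h : IsBarycentric v T β) : 0 < mult v :=
  Nat.pos_of_dvd_of_pos h.mult_dvd.2 (Int.natAbs_pos.2 h.mult_dvd.1)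

theorem IsBarycentric.mult_mul_abs_det_le (h : IsBarycentric v T β) :
    mult v * |(coordMatrix T).det| ≤ β (Fin.last d) := by
  have h1 : (mult v : ℝ) ≤ |((vertexMatrix v).det : ℝ)| := by
    rw [← Int.cast_abs, Int.abs_eq_natAbs, Int.cast_natCast]
    exact_mod_cast Nat.le_of_dvd (Int.natAbs_pos.2 h.mult_dvd.1) h.mult_dvd.2
  calc _ ≤ |((vertexMatrix v).det : ℝ)| * |(coordMatrix T).det| := by gcongr
    _ = |β (Fin.last d)| := by rw [← h.det_mul_det, abs_mul, mul_comm]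
    _ = _ := abs_of_pos (h.pos _)

end VolumeBounds

section SplitForms

/-- A lattice `L` with additive forms `t i`, `a`, `b`, `c` summing to zero, no nonzero lattice point
in the interior of the simplex `-1 / s i ≤ t i`, `-1 / (3 S) ≤ a, b, c`, and lattice points dual to
the forms `t i`. -/
structure IsSplitSystem {L : Type*} [AddCommGroup L] {n : ℕ} (s : Fin n → ℕ) (S : ℕ)
    (t : Fin n → L →+ ℝ) (a b c : L →+ ℝ) : Prop where
  s_pos : ∀ i, 0 < s i
  S_pos : 0 < S
  dvd : ∀ i, s i ∣ S
  sum_eq_zero : ∀ x, ∑ i, t i x + a x + b x + c x = 0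
  eq_zero : ∀ x, (∀ i, -(1 / s i : ℝ) < t i x) → -(1 / (3 * S) : ℝ) < a x →
    -(1 / (3 * S) : ℝ) < b x → -(1 / (3 * S) : ℝ) < c x → x = 0
  exists_dual : ∀ i, ∃ x, (∀ j, t j x = if i = j then (1 / s i : ℝ) else 0) ∧
    a x = -(1 / (3 * s i) : ℝ) ∧ b x = -(1 / (3 * s i) : ℝ) ∧ c x = -(1 / (3 * s i) : ℝ)
  exists_den : ∃ m : ℕ, 0 < m ∧ ∀ x, (∀ i, ∃ k : ℤ, 3 * S * m * t i x = k) ∧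
    (∃ k : ℤ, 3 * S * m * a x = k) ∧ (∃ k : ℤ, 3 * S * m * b x = k)

variable {L : Type*} [AddCommGroup L] {n : ℕ} {s : Fin n → ℕ} {S : ℕ}
  {t : Fin n → L →+ ℝ} {a b c : L →+ ℝ}

theorem IsSplitSystem.exists_reduce (h : IsSplitSystem s S t a b c) (x : L) :
    ∃ (y : L) (k : Fin n → ℤ), (∀ i, t i x = t i y + k i / s i) ∧
      (∀ i, -(1 / s i : ℝ) < t i y ∧ t i y ≤ 0) ∧
      a x = a y - (∑ i, (k i / s i : ℝ)) / 3 ∧ b x = b y - (∑ i, (k i / s i : ℝ)) / 3 ∧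
      c x = c y - (∑ i, (k i / s i : ℝ)) / 3 := by
  choose φ hφt hφa hφb hφc using h.exists_dual
  have hs : ∀ i, (0 : ℝ) < s i := fun i => by exact_mod_cast h.s_pos i
  have haux : ∀ f : L →+ ℝ, (∀ i, f (φ i) = -(1 / (3 * s i) : ℝ)) → ∀ k : Fin n → ℤ,
      f x = f (x - ∑ i, k i • φ i) - (∑ i, (k i / s i : ℝ)) / 3 := by
    intro f hf k
    simp only [map_sub, map_sum, map_zsmul, hf, zsmul_eq_mul, Finset.sum_div]
    have : ∀ i, (k i : ℝ) * -(1 / (3 * s i)) = -(k i / s i / 3) := fun i => by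
      have := hs i
      field_simp
    rw [Finset.sum_congr rfl fun i _ => this i, Finset.sum_neg_distrib]
    ring
  have ht : ∀ i, t i (x - ∑ j, ⌈s j * t j x⌉ • φ j) = t i x - ⌈s i * t i x⌉ / s i := by
    intro i
    simp [hφt, div_eq_mul_inv]
  refine ⟨x - ∑ i, ⌈s i * t i x⌉ • φ i, fun i => ⌈s i * t i x⌉, fun i => by rw [ht]; ring,
    fun i => ?_, haux a hφa _, haux b hφb _, haux c hφc _⟩
  have h1 := Int.le_ceil (s i * t i x)
  have h2 := Int.ceil_lt_add_one (s i * t i x)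
  have hsi := hs i
  rw [ht]
  constructor
  · rw [neg_lt_sub_iff_lt_add, ← sub_lt_iff_lt_add', ← sub_div, div_lt_iff₀ hsi]
    linarith
  · rw [sub_nonpos, le_div_iff₀ hsi]
    linarith

theorem IsSplitSystem.eq_zero_of_forall (h : IsSplitSystem s S t a b c) {x : L}
    (ht : ∀ i, t i x = 0) (ha : a x = 0) (hb : b x = 0) : x = 0 := by
  have hS : (0 : ℝ) < 1 / (3 * S) := by
    have : (0 : ℝ) < S := by exact_mod_cast h.S_pos
    positivity
  have hc : c x = 0 := by
    have := h.sum_eq_zero x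
    simpa [ht, ha, hb] using this
  refine h.eq_zero x (fun i => ?_) (by linarith) (by linarith) (by linarith)
  have : (0 : ℝ) < s i := by exact_mod_cast h.s_pos i
  rw [ht, neg_lt_zero]
  positivity

/-- If the forms `t i`, `a`, `b` are small at `x` in the sense of Minkowski's theorem, then
`(a, b, c) = (0, 1, -1) / (3 S)` for some lattice point at which all `t i` vanish. -/
theorem IsSplitSystem.exists_root (h : IsSplitSystem s S t a b c)
    (hmink : ∀ ε : ℝ, 0 < ε → ∃ x : L, x ≠ 0 ∧ (∀ i, |t i x| < 1 / s i) ∧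
      |a x + (∑ i, t i x) / 3| < 1 / (3 * S) ∧ |b x - c x| < 2 * ((1 + ε) / (3 * S))) :
    ∃ x : L, (∀ i, t i x = 0) ∧ a x = 0 ∧ b x = 1 / (3 * S) ∧ c x = -(1 / (3 * S)) := by
  obtain ⟨m, hm, hden⟩ := h.exists_den
  have hs : ∀ i, (0 : ℝ) < s i := fun i => by exact_mod_cast h.s_pos i
  have hS : (0 : ℝ) < S := by exact_mod_cast h.S_pos
  have hm' : (0 : ℝ) < m := by exact_mod_cast hm
  obtain ⟨x, hx0, hxt, hxa, hxb⟩ := hmink (1 / (6 * m)) (by positivity)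
  obtain ⟨N, hN⟩ : ∃ N : ℝ, N = 1 / (3 * S) := ⟨_, rfl⟩
  have hN0 : 0 < N := by rw [hN]; positivity
  obtain ⟨e, he⟩ : ∃ e : ℝ, e = N / (3 * m) := ⟨_, rfl⟩
  have he0 : 0 < e := by rw [he]; positivity
  have hNe : N = ((3 * m : ℤ) : ℝ) * e := by rw [he]; push_cast; field_simp
  have hlat : ∀ f : L →+ ℝ, (∀ z, ∃ k : ℤ, 3 * S * m * f z = k) → ∀ z, ∃ k : ℤ,
      f z = 3 * k * e := by
    intro f hf z
    obtain ⟨k, hk⟩ := hf z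
    refine ⟨k, ?_⟩
    rw [← hk, he, hN]
    field_simp
  choose kt hkt using fun i => hlat (t i) fun z => (hden z).1 i
  choose ka hka using hlat a fun z => (hden z).2.1
  choose kb hkb using hlat b fun z => (hden z).2.2
  have hσ : ∀ z, ∑ i, t i z = 3 * (∑ i, kt i z : ℤ) * e := fun z => by
    rw [Finset.sum_congr rfl fun i _ => hkt i z, ← Finset.sum_mul, ← Finset.mul_sum]
    push_cast
    rfl
  have hxb' : |b x - c x| < 2 * N + e := by
    convert hxb using 1
    rw [he, hN]
    field_simp
    ring
  rw [← hN] at hxa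
  have hsmall : ∀ z : ℤ, 0 ≤ z * e → z * e < e → z = 0 := by
    intro z h1 h2
    have h3 : (-1 : ℝ) < z := by nlinarith
    have h4 : (z : ℝ) < 1 := by nlinarith
    have h5 : -1 < z := by exact_mod_cast h3
    have h6 : z < 1 := by exact_mod_cast h4
    omega
  -- every admissible `x` reduces to a nonzero point violating one of the two remaining inequalities
  have hred : ∀ x : L, x ≠ 0 → (∀ i, |t i x| < 1 / s i) → |a x + (∑ i, t i x) / 3| < N →
      ∃ y : L, (∀ i, t i y ≤ 0) ∧ a x + (∑ i, t i x) / 3 = a y + (∑ i, t i y) / 3 ∧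
        b x + (∑ i, t i x) / 3 = b y + (∑ i, t i y) / 3 ∧
        c x + (∑ i, t i x) / 3 = c y + (∑ i, t i y) / 3 ∧ (b y ≤ -N ∨ c y ≤ -N) := by
    intro x hx0 hxt hxa
    obtain ⟨y, k, hk, hy, hya, hyb, hyc⟩ := h.exists_reduce x
    have hsum : ∑ i, t i x = ∑ i, t i y + ∑ i, (k i / s i : ℝ) := by
      rw [← Finset.sum_add_distrib]
      exact Finset.sum_congr rfl fun i _ => hk i
    have hσy : ∑ i, t i y ≤ 0 := Finset.sum_nonpos fun i _ => (hy i).2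
    refine ⟨y, fun i => (hy i).2, by linarith, by linarith, by linarith, ?_⟩
    by_contra! hcon
    have hya' : -N < a y := by
      have := (abs_lt.1 hxa).1
      linarith
    have hy0 : y = 0 := by
      rw [hN] at hcon hya'
      exact h.eq_zero y (fun i => (hy i).1) hya' hcon.1 hcon.2
    subst hy0
    have hk0 : ∀ i, k i = 0 := by
      intro i
      have h1 := hxt i
      rw [hk i, map_zero, zero_add, abs_div, Nat.abs_cast, div_lt_div_iff_of_pos_right (hs i)] at h1
      have h2 : |k i| < 1 := by exact_mod_cast h1
      exact Int.abs_lt_one_iff.1 h2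
    simp only [hk0, map_zero, Int.cast_zero, zero_div, Finset.sum_const_zero, sub_zero,
      add_zero] at hk hya hyb
    exact hx0 (h.eq_zero_of_forall hk hya hyb)
  obtain ⟨y, hyt, hya, hyb, hyc, hy⟩ := hred x hx0 hxt hxa
  obtain ⟨z, hzt, hza, hzb, hzc, hz⟩ := hred (-x) (neg_ne_zero.2 hx0) (by simpa using hxt) (by
    simp only [map_neg, Finset.sum_neg_distrib]
    rw [← abs_neg]
    convert hxa using 2
    ring)
  simp only [map_neg, Finset.sum_neg_distrib] at hza hzb hzc
  have hσy : ∑ i, t i y ≤ 0 := Finset.sum_nonpos fun i _ => hyt i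
  have hσz : ∑ i, t i z ≤ 0 := Finset.sum_nonpos fun i _ => hzt i
  have hxs := h.sum_eq_zero x
  have hys := h.sum_eq_zero y
  obtain ⟨hb1, hb2⟩ := abs_lt.1 hxb'
  -- the sum of the nonpositive forms vanishes at `y`
  have hσ0 : ∀ (_ : -(∑ i, t i y) < 3 * e), ∀ i, t i y = 0 := by
    intro h1
    have h2 : ∑ i, t i y = 0 := by
      have h3 := hσ y
      have h4 := hsmall (-(∑ i, kt i y)) (by push_cast at h3 ⊢; linarith)
        (by push_cast at h3 ⊢; linarith)
      rw [h3, neg_eq_zero.1 h4]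
      simp
    intro i
    exact (Finset.sum_eq_zero_iff_of_nonpos fun i _ => hyt i).1 h2 i (Finset.mem_univ i)
  have ha0 : -e < a y → a y < e → a y = 0 := by
    intro hl hu
    have h1 := hka y
    obtain h2 | h2 := le_total 0 (a y)
    · have h3 := hsmall (3 * ka y) (by push_cast; linarith) (by push_cast; linarith)
      rw [h1, (by omega : ka y = 0)]
      simp
    · have h3 := hsmall (-(3 * ka y)) (by push_cast; linarith) (by push_cast; linarith)
      rw [h1, (by omega : ka y = 0)]
      simp
  obtain hy | hy := hy <;> obtain hz | hz := hz
  · linarith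
  · have hty := hσ0 (by linarith)
    have hty' : ∑ i, t i y = 0 := Finset.sum_eq_zero fun i _ => hty i
    have h1 : b y = -N := by
      have h2 := hsmall (-(3 * kb y) - 3 * m)
      have h3 := hkb y
      push_cast at h2 hNe
      have h4 := h2 (by linarith) (by linarith)
      have h5 : (-(3 * kb y) - 3 * m : ℝ) = 0 := by exact_mod_cast h4
      rw [h3, hNe]
      linear_combination (-e) * h5
    have h6 : a y = 0 := ha0 (by linarith) (by linarith)
    refine ⟨-y, fun i => by simp [hty], by simp [h6], by rw [map_neg, h1, hN, neg_neg], ?_⟩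
    rw [map_neg, ← hN]
    linarith
  · have hty := hσ0 (by linarith)
    have hty' : ∑ i, t i y = 0 := Finset.sum_eq_zero fun i _ => hty i
    have h1 : c y = -N := by
      have h2 := hsmall (3 * ka y + 3 * kb y - 3 * m)
      have h3 := hkb y
      have h3' := hka y
      push_cast at h2 hNe
      have h4 := h2 (by linarith) (by linarith)
      have h5 : (3 * ka y + 3 * kb y - 3 * m : ℝ) = 0 := by exact_mod_cast h4
      linear_combination hys - hty' - h3 - h3' + hNe - e * h5
    have h6 : a y = 0 := ha0 (by linarith) (by linarith)
    refine ⟨y, hty, h6, ?_, by rw [h1, hN]⟩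
    rw [← hN]
    linarith
  · linarith

/-- The forms `s i * t i`, `3 S a` and `3 S b` are integral. -/
theorem IsSplitSystem.integral (h : IsSplitSystem s S t a b c)
    (hu : ∃ x : L, (∀ i, t i x = 0) ∧ a x = 0 ∧ b x = 1 / (3 * S) ∧ c x = -(1 / (3 * S)))
    (hw : ∃ x : L, (∀ i, t i x = 0) ∧ b x = 0 ∧ a x = 1 / (3 * S) ∧ c x = -(1 / (3 * S)))
    (x : L) : (∀ i, ∃ k : ℤ, s i * t i x = k) ∧ (∃ k : ℤ, 3 * S * a x = k) ∧
      ∃ k : ℤ, 3 * S * b x = k := by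
  obtain ⟨u, hut, hua, hub, huc⟩ := hu
  obtain ⟨w, hwt, hwb, hwa, hwc⟩ := hw
  have hs : ∀ i, (0 : ℝ) < s i := fun i => by exact_mod_cast h.s_pos i
  have hS : (0 : ℝ) < S := by exact_mod_cast h.S_pos
  obtain ⟨y, k, hk, hy, hya, hyb, hyc⟩ := h.exists_reduce x
  have hceil : ∀ r : ℝ, -(1 / (3 * S) : ℝ) < r - ⌈3 * S * r⌉ * (1 / (3 * S)) ∧
      r - ⌈3 * S * r⌉ * (1 / (3 * S)) ≤ 0 := by
    intro r
    have h1 := Int.le_ceil (3 * S * r)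
    have h2 := Int.ceil_lt_add_one (3 * S * r)
    rw [mul_one_div]
    constructor
    · rw [neg_lt_sub_iff_lt_add, ← sub_lt_iff_lt_add', ← sub_div, div_lt_iff₀ (by positivity)]
      linarith
    · rw [sub_nonpos, le_div_iff₀ (by positivity)]
      linarith
  have hz0 : y - ⌈3 * S * a y⌉ • w - ⌈3 * S * b y⌉ • u = 0 := by
    have hsum := h.sum_eq_zero (y - ⌈3 * S * a y⌉ • w - ⌈3 * S * b y⌉ • u)
    have ht : ∀ i, t i (y - ⌈3 * S * a y⌉ • w - ⌈3 * S * b y⌉ • u) = t i y := fun i => by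
      simp [hwt, hut]
    have ha : a (y - ⌈3 * S * a y⌉ • w - ⌈3 * S * b y⌉ • u) =
        a y - ⌈3 * S * a y⌉ * (1 / (3 * S)) := by
      simp only [map_sub, map_zsmul, zsmul_eq_mul, hua, hwa]
      ring
    have hb : b (y - ⌈3 * S * a y⌉ • w - ⌈3 * S * b y⌉ • u) =
        b y - ⌈3 * S * b y⌉ * (1 / (3 * S)) := by
      simp only [map_sub, map_zsmul, zsmul_eq_mul, hub, hwb]
      ring
    have hσ : ∑ i, t i y ≤ 0 := Finset.sum_nonpos fun i _ => (hy i).2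
    refine h.eq_zero _ (fun i => ?_) ?_ ?_ ?_
    · rw [ht]
      exact (hy i).1
    · rw [ha]
      exact (hceil _).1
    · rw [hb]
      exact (hceil _).1
    · simp only [ht, ha, hb] at hsum
      have h1 := (hceil (a y)).2
      have h2 := (hceil (b y)).2
      have h3 : (0 : ℝ) < 1 / (3 * S) := by positivity
      linarith
  have hyeq : y = ⌈3 * S * a y⌉ • w + ⌈3 * S * b y⌉ • u := by
    rw [sub_sub, sub_eq_zero] at hz0
    exact hz0
  have hyt : ∀ i, t i y = 0 := fun i => by rw [hyeq]; simp [hwt, hut]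
  have hya' : 3 * S * a y = ⌈3 * S * a y⌉ := by
    conv_lhs => rw [hyeq]
    simp only [map_add, map_zsmul, zsmul_eq_mul, hua, hwa]
    field_simp
    ring
  have hyb' : 3 * S * b y = ⌈3 * S * b y⌉ := by
    conv_lhs => rw [hyeq]
    simp only [map_add, map_zsmul, zsmul_eq_mul, hub, hwb]
    field_simp
    ring
  choose q hq using h.dvd
  have hint : S * ∑ i, (k i / s i : ℝ) = (∑ i, q i * k i : ℤ) := by
    push_cast
    rw [Finset.mul_sum]
    refine Finset.sum_congr rfl fun i _ => ?_
    have h1 : (S : ℝ) = s i * q i := by exact_mod_cast hq i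
    have := hs i
    rw [h1]
    field_simp
  refine ⟨fun i => ⟨k i, ?_⟩, ⟨⌈3 * S * a y⌉ - ∑ i, q i * k i, ?_⟩,
    ⟨⌈3 * S * b y⌉ - ∑ i, q i * k i, ?_⟩⟩
  · rw [hk, hyt, zero_add, mul_div_cancel₀ _ (hs i).ne']
  · rw [Int.cast_sub, ← hya', ← hint, hya]
    ring
  · rw [Int.cast_sub, ← hyb', ← hint, hyb]
    ring

end SplitForms

section ExtremalSystem

theorem prod_sylv_nat (n : ℕ) : ∏ i ∈ Finset.range n, sylv i = sylv n - 1 := by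
  have h := prod_sylv n
  have h2 := two_le_sylv n
  rw [← Nat.cast_one, ← Nat.cast_sub (by omega)] at h
  exact_mod_cast h

theorem sylv_dvd {i n : ℕ} (hi : i < n) : sylv i ∣ sylv n - 1 := by
  rw [← prod_sylv_nat]
  exact Finset.dvd_prod_of_mem _ (Finset.mem_range.2 hi)

theorem cast_sylv_sub_one (n : ℕ) : ((sylv n - 1 : ℕ) : ℝ) = (sylv n : ℝ) - 1 := by
  have := two_le_sylv n
  rw [Nat.cast_sub (by omega), Nat.cast_one]

/-- The reciprocals of the barycentric weights of the origin in the extremal simplex. -/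
def weightDen (n j : ℕ) : ℕ := if j < n then sylv j else 3 * (sylv n - 1)

theorem weightDen_pos (n j : ℕ) : 0 < weightDen n j := by
  have h1 := two_le_sylv n
  have h2 := two_le_sylv j
  unfold weightDen
  split_ifs <;> omega

theorem weightDen_dvd (n j : ℕ) : weightDen n j ∣ 3 * (sylv n - 1) := by
  unfold weightDen
  split_ifs with hj
  · exact (sylv_dvd hj).mul_left 3
  · exact dvd_rfl

theorem weightDen_of_lt {n j : ℕ} (hj : j < n) : weightDen n j = sylv j := if_pos hj

theorem weightDen_of_le {n j : ℕ} (hj : n ≤ j) : (weightDen n j : ℝ) = 3 * ((sylv n : ℝ) - 1) := by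
  rw [weightDen, if_neg (by omega)]
  push_cast [cast_sylv_sub_one]
  rfl

variable {n : ℕ} {v : Fin (n + 2 + 1) → Fin (n + 2) → ℤ}
  {T : Fin (n + 2 + 1) → (Fin (n + 2) → ℝ) →ₗ[ℝ] ℝ} {β : Fin (n + 2 + 1) → ℝ}

theorem IsBarycentric.weight_eq (hn : 3 ≤ n) (h : IsBarycentric v T β) (hanti : Antitone β)
    (hm : mult v = 3 * (sylv n - 1) ^ 2) :
    (∀ j, β j = 1 / (weightDen n j : ℝ)) ∧
      |(coordMatrix T).det| = ∏ j : Fin (n + 2), β j.castSucc := by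
  set x : ℕ → ℝ := fun i => if hi : i < n + 2 + 1 then β ⟨i, hi⟩ else 0 with hx
  have hxβ : ∀ j : Fin (n + 2 + 1), x j = β j := fun j => dif_pos j.isLt
  have hxpos : ∀ i < n + 3, 0 < x i := fun i hi => by
    rw [← Fin.val_mk hi, hxβ]
    exact h.pos _
  have hxanti : ∀ i < n + 2, x (i + 1) ≤ x i := fun i hi => by
    rw [← Fin.val_mk (by omega : i < n + 3), ← Fin.val_mk (by omega : i + 1 < n + 3), hxβ, hxβ]
    exact hanti (by simp [Fin.le_def])
  have hsum : ∑ i ∈ Finset.range (n + 3), x i = 1 := by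
    rw [Finset.sum_range, ← h.sum_weight]
    exact Finset.sum_congr rfl fun i _ => hxβ i
  have hprod : ∏ j : Fin (n + 2), β j.castSucc = ∏ i ∈ Finset.range (n + 2), x i := by
    rw [Finset.prod_range]
    exact Finset.prod_congr rfl fun i _ => (hxβ i.castSucc).symm
  have hps : ∀ j ≤ n, ∏ i ∈ Finset.range j, x i ≤ 1 - ∑ i ∈ Finset.range j, x i := by
    intro j hj
    have := h.prod_le (s := Finset.univ.map (Fin.castLEEmb (by omega : j ≤ n + 2 + 1)))
      (k := Fin.last (n + 2)) (by
        simp only [Finset.mem_map, not_exists, not_and]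
        intro i _ hi
        have := congrArg Fin.val hi
        simp at this
        omega)
    rw [Finset.prod_map, Finset.sum_map] at this
    have hxe : ∀ i : Fin j, x i = β (Fin.castLEEmb (by omega : j ≤ n + 2 + 1) i) :=
      fun i => hxβ (Fin.castLEEmb (by omega : j ≤ n + 2 + 1) i)
    rw [Finset.prod_range, Finset.sum_range]
    simp_rw [hxe]
    exact this
  have hW := h.mult_mul_abs_det_le
  have hdet := h.prod_le_abs_det
  have hmS : (mult v : ℝ) = 3 * ((sylv n : ℝ) - 1) ^ 2 := by
    rw [hm]
    push_cast [cast_sylv_sub_one]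
    rfl
  have hS := cast_sylv_sub_one_pos n
  rw [hmS, ← hxβ, Fin.val_last] at hW
  rw [hprod] at hdet ⊢
  have hmP : (3 * ((sylv n : ℝ) - 1) ^ 2) * ∏ i ∈ Finset.range (n + 2), x i ≤ x (n + 2) :=
    le_trans (by gcongr) hW
  rw [Finset.prod_range_succ, Finset.prod_range_succ] at hmP
  have hx0 := hxpos n (by omega)
  have hx1 := hxpos (n + 1) (by omega)
  have ha0 := hxanti n (by omega)
  have ha1 := hxanti (n + 1) (by omega)
  rw [Finset.sum_range_succ, Finset.sum_range_succ, Finset.sum_range_succ] at hsum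
  obtain ⟨hxs, hxn⟩ := eq_sylvester_of_prod_le hn (fun i hi => hxpos i (by omega))
    (fun i hi => hxanti i (by omega)) hps (by linarith) (by
      refine le_of_mul_le_mul_right ?_ hx1
      linarith)
  have hP : ∏ i ∈ Finset.range n, x i = 1 / ((sylv n : ℝ) - 1) := by
    rw [Finset.prod_congr rfl fun i hi => hxs i (by simpa using hi), Finset.prod_div_distrib,
      prod_sylv]
    simp
  have hsumn : ∑ i ∈ Finset.range n, x i = 1 - 1 / ((sylv n : ℝ) - 1) := by
    rw [Finset.sum_congr rfl fun i hi => hxs i (by simpa using hi), sum_inv_sylv]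
  have h12 : x (n + 1) ≤ x (n + 2) := by
    refine le_trans (le_of_eq ?_) hmP
    rw [hP, hxn]
    field_simp
  have hthird : 1 / ((sylv n : ℝ) - 1) = 3 * (1 / (3 * ((sylv n : ℝ) - 1))) := by field_simp
  have hxn1 : x (n + 1) = 1 / (3 * ((sylv n : ℝ) - 1)) := by linarith
  have hxn2 : x (n + 2) = 1 / (3 * ((sylv n : ℝ) - 1)) := by linarith
  refine ⟨fun j => ?_, le_antisymm ?_ hdet⟩
  · rw [← hxβ]
    obtain hj | hj := lt_or_ge (j : ℕ) n
    · rw [weightDen_of_lt hj, hxs _ hj]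
    · rw [weightDen_of_le hj]
      have := j.isLt
      obtain h1 | h1 | h1 : (j : ℕ) = n ∨ (j : ℕ) = n + 1 ∨ (j : ℕ) = n + 2 := by omega
      · rw [h1, hxn]
      · rw [h1, hxn1]
      · rw [h1, hxn2]
  · refine le_of_mul_le_mul_left (hW.trans (le_of_eq ?_))
      (by positivity : 0 < 3 * ((sylv n : ℝ) - 1) ^ 2)
    rw [Finset.prod_range_succ, Finset.prod_range_succ, hP, hxn, hxn1, hxn2]
    field_simp

/-- A linear form restricted to the integer lattice. -/
def intForm {d : ℕ} (f : (Fin d → ℝ) →ₗ[ℝ] ℝ) : (Fin d → ℤ) →+ ℝ where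
  toFun x := f (toR x)
  map_zero' := by
    have : toR (0 : Fin d → ℤ) = 0 := by ext; simp [toR]
    rw [this, map_zero]
  map_add' x y := by rw [toR_add, map_add]

theorem intForm_apply {d : ℕ} (f : (Fin d → ℝ) →ₗ[ℝ] ℝ) (x : Fin d → ℤ) :
    intForm f x = f (toR x) := rfl

theorem intForm_zsmul {d : ℕ} (f : (Fin d → ℝ) →ₗ[ℝ] ℝ) (k : ℤ) (x : Fin d → ℤ) :
    intForm f (k • x) = k * intForm f x := by
  rw [intForm_apply, toR_zsmul, map_smul, smul_eq_mul, intForm_apply]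

theorem IsBarycentric.exists_int_mul_eq (h : IsBarycentric v T β)
    (hβ : ∀ j, β j = 1 / (weightDen n j : ℝ)) (x : Fin (n + 2) → ℤ) (j : Fin (n + 2 + 1)) :
    ∃ k : ℤ, 3 * ((sylv n - 1 : ℕ) : ℝ) * mult v * intForm (T j) x = k := by
  have key : ∀ y ∈ AddSubgroup.closure (Set.range v),
      ∃ k : ℤ, 3 * ((sylv n - 1 : ℕ) : ℝ) * intForm (T j) y = k := by
    intro y hy
    induction hy using AddSubgroup.closure_induction with
    | mem y hy =>
      obtain ⟨l, rfl⟩ := hy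
      obtain ⟨q, hq⟩ := weightDen_dvd n j
      have h1 : 3 * ((sylv n - 1 : ℕ) : ℝ) = weightDen n j * q := by exact_mod_cast hq
      have h2 : (0 : ℝ) < weightDen n j := by exact_mod_cast weightDen_pos n j
      refine ⟨(if j = l then 3 * (sylv n - 1 : ℕ) else 0) - q, ?_⟩
      rw [intForm_apply, h.apply_vertex, hβ, mul_sub]
      have h3 : 3 * ((sylv n - 1 : ℕ) : ℝ) * (1 / weightDen n j) = q := by
        rw [h1]
        field_simp
      rw [h3]
      split_ifs <;> simp
    | zero => exact ⟨0, by simp⟩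
    | add y z _ _ hy hz =>
      obtain ⟨k, hk⟩ := hy
      obtain ⟨l, hl⟩ := hz
      exact ⟨k + l, by rw [map_add, mul_add, hk, hl]; push_cast; rfl⟩
    | neg y _ hy =>
      obtain ⟨k, hk⟩ := hy
      exact ⟨-k, by rw [map_neg, mul_neg, hk]; push_cast; rfl⟩
  obtain ⟨k, hk⟩ := key (mult v • x) (AddSubgroup.nsmul_index_mem _ x)
  refine ⟨k, ?_⟩
  rw [← hk, map_nsmul, nsmul_eq_mul]
  ring

theorem IsBarycentric.exists_dual (h : IsBarycentric v T β)
    (hβ : ∀ j, β j = 1 / (weightDen n j : ℝ)) {i : Fin (n + 2 + 1)} (hi : (i : ℕ) < n) :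
    ∃ x : Fin (n + 2) → ℤ, ∀ j : Fin (n + 2 + 1), intForm (T j) x =
      if (j : ℕ) < n then (if j = i then 1 / (sylv i : ℝ) else 0) else -(1 / (3 * sylv i) : ℝ) := by
  obtain ⟨k, hk⟩ := sylv_dvd hi
  have hs : ∀ j, (0 : ℝ) < sylv j := fun j => by linarith [two_le_cast_sylv j]
  have hkS : (sylv n : ℝ) - 1 = sylv i * k := by
    rw [← cast_sylv_sub_one]
    exact_mod_cast hk
  have hS := cast_sylv_sub_one_pos n
  have hm : ∀ j : Fin (n + 2 + 1), ∃ m : ℤ,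
      (m : ℝ) = if (j : ℕ) < n then (if j = i then 0 else (k : ℝ) / sylv j) else 0 := by
    intro j
    split_ifs with h1 h2
    · exact ⟨0, by simp⟩
    · have hdvd : sylv j ∣ k := by
        have hmem : (i : ℕ) ∈ Finset.range n := Finset.mem_range.2 hi
        have h3 := Finset.mul_prod_erase (Finset.range n) sylv hmem
        rw [prod_sylv_nat, hk] at h3
        have h4 : ∏ l ∈ (Finset.range n).erase i, sylv l = k :=
          Nat.eq_of_mul_eq_mul_left (by have := two_le_sylv i; omega) h3
        rw [← h4]
        exact Finset.dvd_prod_of_mem _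
          (Finset.mem_erase.2 ⟨fun h5 => h2 (Fin.ext h5), Finset.mem_range.2 h1⟩)
      obtain ⟨m, hm⟩ := hdvd
      refine ⟨m, ?_⟩
      have := hs j
      rw [hm]
      push_cast
      field_simp
    · exact ⟨0, by simp⟩
  choose m hm using hm
  have hsum : ∑ j, (m j : ℝ) = k * (1 - 1 / ((sylv n : ℝ) - 1)) - k / sylv i := by
    have h1 : ∀ j : Fin (n + 2 + 1), (m j : ℝ) =
        (if (j : ℕ) < n then (k : ℝ) / sylv j else 0) - if j = i then (k : ℝ) / sylv i else 0 := by
      intro j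
      rw [hm]
      split_ifs with h1 h2 h2
      · rw [h2, sub_self]
      · ring
      · exact absurd (h2 ▸ hi) h1
      · ring
    simp_rw [h1, Finset.sum_sub_distrib]
    have h2 : ∑ j : Fin (n + 2 + 1), (if (j : ℕ) < n then (k : ℝ) / sylv j else 0) =
        k * (1 - 1 / ((sylv n : ℝ) - 1)) := by
      rw [← sum_inv_sylv, Fin.sum_univ_castSucc, Fin.sum_univ_castSucc, Fin.sum_univ_castSucc,
        Finset.sum_range, Finset.mul_sum]
      simp [div_eq_mul_inv]
    rw [h2]
    simp
  refine ⟨∑ j, m j • (v j - v i) + (k : ℤ) • v i, fun j => ?_⟩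
  have h1 : intForm (T j) (∑ j, m j • (v j - v i) + (k : ℤ) • v i) =
      m j - (if j = i then ∑ l, (m l : ℝ) else 0) + k * ((if j = i then 1 else 0) - β j) := by
    have h2 : ∀ l, intForm (T j) (v l) = (if j = l then 1 else 0) - β j :=
      fun l => h.apply_vertex j l
    simp only [map_add, map_sum, intForm_zsmul, map_sub, h2, sub_sub_sub_cancel_right, mul_sub,
      Finset.sum_sub_distrib, mul_ite, mul_one, mul_zero,
      Finset.sum_ite_eq, Finset.mem_univ, if_true, Int.cast_natCast]
    split_ifs <;> simp
  rw [h1, hm, hβ, hsum]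
  have hsi := hs i
  by_cases hj : (j : ℕ) < n
  · rw [if_pos hj, if_pos hj, weightDen_of_lt hj]
    by_cases hji : j = i
    · subst hji
      simp only [if_true]
      rw [hkS]
      have hk0 : (0 : ℝ) < k := by
        rw [hkS] at hS
        exact pos_of_mul_pos_right hS hsi.le
      field_simp
      ring
    · simp only [hji, if_false]
      ring
  · have hji : j ≠ i := fun h2 => hj (h2 ▸ hi)
    rw [if_neg hj, if_neg hj, weightDen_of_le (by omega)]
    simp only [hji, if_false]
    rw [hkS]
    have hk0 : (0 : ℝ) < k := by
      rw [hkS] at hS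
      exact pos_of_mul_pos_right hS hsi.le
    field_simp
    ring

theorem IsBarycentric.isSplitSystem (h : IsBarycentric v T β)
    (hβ : ∀ j, β j = 1 / (weightDen n j : ℝ)) :
    IsSplitSystem (fun i : Fin n => sylv i) (sylv n - 1)
      (fun i => intForm (T i.castSucc.castSucc.castSucc))
      (intForm (T (Fin.last n).castSucc.castSucc)) (intForm (T (Fin.last (n + 1)).castSucc))
      (intForm (T (Fin.last (n + 2)))) where
  s_pos i := by have := two_le_sylv i; omega
  S_pos := by have := two_le_sylv n; omega
  dvd i := sylv_dvd i.isLt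
  sum_eq_zero x := by
    rw [← h.sum_apply (toR x), Fin.sum_univ_castSucc, Fin.sum_univ_castSucc, Fin.sum_univ_castSucc]
    rfl
  eq_zero x ht ha hb hc := by
    refine h.eq_zero x fun j => ?_
    rw [hβ]
    rw [cast_sylv_sub_one] at ha hb hc
    induction j using Fin.lastCases with
    | last => rw [weightDen_of_le (by simp)]; exact hc
    | cast j =>
      induction j using Fin.lastCases with
      | last => rw [weightDen_of_le (by simp)]; exact hb
      | cast j =>
        induction j using Fin.lastCases with
        | last => rw [weightDen_of_le (by simp)]; exact ha
        | cast j => rw [weightDen_of_lt (by simp)]; exact ht j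
  exists_dual i := by
    obtain ⟨x, hx⟩ := h.exists_dual hβ (i := i.castSucc.castSucc.castSucc) (by simp)
    refine ⟨x, fun j => ?_, ?_, ?_, ?_⟩
    · rw [hx]
      simp [Fin.ext_iff, eq_comm]
    · rw [hx]
      simp
    · rw [hx]
      simp
    · rw [hx]
      simp
  exists_den := ⟨mult v, h.mult_pos, fun x => ⟨fun i => h.exists_int_mul_eq hβ x _,
    h.exists_int_mul_eq hβ x _, h.exists_int_mul_eq hβ x _⟩⟩

end ExtremalSystem

section Forward

variable {n : ℕ} {v : Fin (n + 2 + 1) → Fin (n + 2) → ℤ}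
  {T : Fin (n + 2 + 1) → (Fin (n + 2) → ℝ) →ₗ[ℝ] ℝ} {β : Fin (n + 2 + 1) → ℝ}

theorem hullOf_comp_perm {d : ℕ} (v : Fin (d + 1) → Fin d → ℤ) (σ : Equiv.Perm (Fin (d + 1))) :
    hullOf (v ∘ σ) = hullOf v :=
  congrArg (convexHull ℝ) (σ.surjective.range_comp fun i => toR (v i))

theorem mult_comp_perm {d : ℕ} (v : Fin (d + 1) → Fin d → ℤ) (σ : Equiv.Perm (Fin (d + 1))) :
    mult (v ∘ σ) = mult v := by
  rw [mult, mult, σ.surjective.range_comp]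

theorem IsBarycentric.exists_small (h : IsBarycentric v T β)
    (hβ : ∀ j, β j = 1 / (weightDen n j : ℝ))
    (hdet : |(coordMatrix T).det| = ∏ j : Fin (n + 2), β j.castSucc) {ε : ℝ} (hε : 0 < ε) :
    ∃ x : Fin (n + 2) → ℤ, x ≠ 0 ∧
      (∀ i : Fin n, |intForm (T i.castSucc.castSucc.castSucc) x| < 1 / (sylv i : ℝ)) ∧
      |intForm (T (Fin.last n).castSucc.castSucc) x +
        (∑ i : Fin n, intForm (T i.castSucc.castSucc.castSucc) x) / 3| <
          1 / (3 * ((sylv n - 1 : ℕ) : ℝ)) ∧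
      |intForm (T (Fin.last (n + 1)).castSucc) x - intForm (T (Fin.last (n + 2))) x| <
        2 * ((1 + ε) / (3 * ((sylv n - 1 : ℕ) : ℝ))) := by
  let U : Matrix (Fin (n + 2)) (Fin (n + 2)) ℝ := Matrix.of fun i j =>
    if (i : ℕ) = j then 1 else if (j : ℕ) < i then
      (if (i : ℕ) = n + 1 then 1 / 2 else if (i : ℕ) = n then 1 / 3 else 0)
    else 0
  have hU : U.det = 1 := by
    rw [Matrix.det_of_isLowerTriangular]
    · simp [U]
    · intro i j hij
      have hij' : (i : ℕ) < j := hij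
      simp [U, hij'.ne, (Fin.lt_def.2 hij').not_gt]
  have hdetU : |(U * coordMatrix T).det| = ∏ j : Fin (n + 2), β j.castSucc := by
    rw [Matrix.det_mul, hU, one_mul, hdet]
  have hmul : ∀ (x : Fin (n + 2) → ℤ) i, (U * coordMatrix T).mulVec (fun j => (x j : ℝ)) i =
      ∑ j, U i j * intForm (T j.castSucc) x := by
    intro x i
    rw [← Matrix.mulVec_mulVec]
    change ∑ j, U i j * (coordMatrix T).mulVec (toR x) j = _
    simp only [coordMatrix_mulVec, intForm_apply]
  have hpos : ∏ j : Fin (n + 2), β j.castSucc < ∏ j : Fin (n + 2),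
      if (j : ℕ) = n + 1 then (1 + ε) * β j.castSucc else β j.castSucc := by
    have hne : ∀ j : Fin (n + 1), (j.castSucc : ℕ) ≠ n + 1 := fun j => j.isLt.ne
    simp only [Fin.prod_univ_castSucc (n := n + 1), hne, Fin.val_last, if_false, if_true]
    have h1 : 0 < ∏ j : Fin (n + 1), β j.castSucc.castSucc := Finset.prod_pos fun i _ => h.pos _
    have h2 := h.pos (Fin.last (n + 1)).castSucc
    gcongr
    nlinarith
  obtain ⟨x, hx0, hx⟩ := exists_int_ne_zero_abs_mulVec_lt (U * coordMatrix T)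
    (by rw [Matrix.det_mul, hU, one_mul]; exact h.det_coordMatrix_ne_zero)
    (fun j => if (j : ℕ) = n + 1 then (1 + ε) * β j.castSucc else β j.castSucc)
    (fun j => by
      have := h.pos j.castSucc
      split_ifs <;> positivity)
    (by rw [hdetU]; exact hpos)
  simp only [hmul] at hx
  refine ⟨x, hx0, fun i => ?_, ?_, ?_⟩
  · have hi1 : (i : ℕ) ≠ n + 1 := by have := i.isLt; omega
    have := hx i.castSucc.castSucc
    simpa [U, hβ, weightDen_of_lt, Fin.sum_univ_castSucc, Fin.val_inj, i.isLt.ne, hi1,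
      ite_mul] using this
  · have := hx (Fin.last n).castSucc
    have hne : ∀ i : Fin n, n ≠ (i : ℕ) := fun i => i.isLt.ne'
    simp [U, hβ, weightDen_of_le, Fin.sum_univ_castSucc, hne, ← Finset.mul_sum,
      (Fin.castSucc_lt_last (Fin.last n)).not_gt] at this
    rw [cast_sylv_sub_one]
    convert this using 1
    · congr 1
      ring
    · simp
  · have := hx (Fin.last (n + 1))
    have hne : ∀ i : Fin n, n + 1 ≠ (i : ℕ) := fun i => by have := i.isLt; omega
    simp [U, hβ, weightDen_of_le, Fin.sum_univ_castSucc, hne, ← Finset.mul_sum] at this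
    have hsum := h.sum_apply (toR x)
    rw [Fin.sum_univ_castSucc, Fin.sum_univ_castSucc, Fin.sum_univ_castSucc] at hsum
    simp only [intForm_apply] at this ⊢
    have h2 : T (Fin.last (n + 1)).castSucc (toR x) - T (Fin.last (n + 2)) (toR x) =
        2 * (2⁻¹ * ∑ i : Fin n, T i.castSucc.castSucc.castSucc (toR x) +
          2⁻¹ * T (Fin.last n).castSucc.castSucc (toR x) +
          T (Fin.last (n + 1)).castSucc (toR x)) := by
      linarith
    rw [h2, abs_mul, abs_two, cast_sylv_sub_one]
    refine mul_lt_mul_of_pos_left (this.trans_eq ?_) two_pos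
    field_simp

theorem IsBarycentric.integral (hn : 3 ≤ n) (h : IsBarycentric v T β) (hanti : Antitone β)
    (hm : mult v = 3 * (sylv n - 1) ^ 2) (x : Fin (n + 2) → ℤ) (j : Fin (n + 2)) :
    ∃ k : ℤ, weightDen n j * intForm (T j.castSucc) x = k := by
  obtain ⟨hβ, hdet⟩ := h.weight_eq hn hanti hm
  have hsys := h.isSplitSystem hβ
  have hu := hsys.exists_root fun ε hε => h.exists_small hβ hdet hε
  set σ : Equiv.Perm (Fin (n + 2 + 1)) :=
    Equiv.swap (Fin.last n).castSucc.castSucc (Fin.last (n + 1)).castSucc with hσ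
  have hβσ : β ∘ σ = β := by
    funext j
    simp only [Function.comp_apply, hβ, hσ]
    congr 1
    rw [Equiv.swap_apply_def]
    split_ifs with h1 h2
    · rw [h1, weightDen_of_le (by simp), weightDen_of_le (by simp)]
    · rw [h2, weightDen_of_le (by simp), weightDen_of_le (by simp)]
    · rfl
  have h' := h.perm σ
  rw [hβσ] at h'
  have hdet' := (h'.weight_eq hn hanti (by rw [mult_comp_perm, hm])).2
  have hsys' := h'.isSplitSystem hβ
  obtain ⟨w, hwt, hwa, hwb, hwc⟩ := hsys'.exists_root fun ε hε => h'.exists_small hβ hdet' hε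
  have hσt : ∀ i : Fin n, σ i.castSucc.castSucc.castSucc = i.castSucc.castSucc.castSucc := fun i =>
    Equiv.swap_apply_of_ne_of_ne
      (by simp [Fin.ext_iff, i.isLt.ne]) (by have := i.isLt; simp [Fin.ext_iff]; omega)
  have hσa : σ (Fin.last n).castSucc.castSucc = (Fin.last (n + 1)).castSucc :=
    Equiv.swap_apply_left _ _
  have hσb : σ (Fin.last (n + 1)).castSucc = (Fin.last n).castSucc.castSucc :=
    Equiv.swap_apply_right _ _
  have hσc : σ (Fin.last (n + 2)) = Fin.last (n + 2) :=
    Equiv.swap_apply_of_ne_of_ne (by simp [Fin.ext_iff]) (by simp [Fin.ext_iff])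
  simp only [Function.comp_apply, hσt, hσa, hσb, hσc] at hwt hwa hwb hwc
  obtain ⟨ht, ha, hb⟩ := hsys.integral hu ⟨w, hwt, hwa, hwb, hwc⟩ x
  rw [cast_sylv_sub_one] at ha hb
  induction j using Fin.lastCases with
  | last => rw [weightDen_of_le (by simp)]; exact hb
  | cast j =>
    induction j using Fin.lastCases with
    | last => rw [weightDen_of_le (by simp)]; exact ha
    | cast j => rw [weightDen_of_lt (by simp)]; exact ht j

theorem mainV_zero (n : ℕ) (l : Fin (n + 2)) : mainV (n + 2) 0 l = -1 := by simp [mainV]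

theorem mainV_succ (n : ℕ) (j l : Fin (n + 2)) :
    mainV (n + 2) j.succ l = (if l = j then (weightDen n j : ℤ) else 0) - 1 := by
  have := two_le_sylv n
  simp only [mainV, weightDen, Fin.val_succ, add_left_inj, Fin.ext_iff, Nat.add_sub_cancel,
    Nat.succ_le_iff]
  split_ifs <;> simp
  omega

theorem range_eq_of_rotate {α : Type*} {d : ℕ} {f g : Fin (d + 1) → α}
    (h : ∀ j : Fin d, g j.castSucc = f j.succ) (h0 : g (Fin.last d) = f 0) :
    Set.range g = Set.range f := by
  refine Set.Subset.antisymm ?_ ?_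
  · rintro _ ⟨i, rfl⟩
    induction i using Fin.lastCases with
    | last => exact ⟨0, h0.symm⟩
    | cast j => exact ⟨j.succ, (h j).symm⟩
  · rintro _ ⟨i, rfl⟩
    induction i using Fin.cases with
    | zero => exact ⟨Fin.last d, h0⟩
    | succ j => exact ⟨j.castSucc, h j⟩

theorem image_hullOf {d : ℕ} (A : Matrix (Fin d) (Fin d) ℤ) (w : Fin d → ℤ)
    (v : Fin (d + 1) → Fin d → ℤ) :
    (fun x => (A.map fun m : ℤ => (m : ℝ)).mulVec x + toR w) '' hullOf v =
      hullOf fun i => A.mulVec (v i) + w := by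
  have h1 := AffineMap.image_convexHull
    ((Matrix.mulVecLin (A.map fun m : ℤ => (m : ℝ))).toAffineMap +
      AffineMap.const ℝ (Fin d → ℝ) (toR w)) (Set.range fun i => toR (v i))
  refine h1.trans ?_
  rw [hullOf, ← Set.range_comp]
  congr 2
  funext i l
  simp [toR, Matrix.mulVec, dotProduct]

theorem IsBarycentric.unimodEquiv (hn : 3 ≤ n) (h : IsBarycentric v T β) (hanti : Antitone β)
    (hm : mult v = 3 * (sylv n - 1) ^ 2) : UnimodEquiv (hullOf v) (hullOf (mainV (n + 2))) := by
  obtain ⟨hβ, hdet⟩ := h.weight_eq hn hanti hm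
  choose A hA using fun l j : Fin (n + 2) => h.integral hn hanti hm (Pi.single j 1) l
  have hw : ∀ j, (0 : ℝ) < weightDen n j := fun j => by exact_mod_cast weightDen_pos n j
  have hsingle : ∀ j : Fin (n + 2), toR (Pi.single j 1) = (Pi.single j 1 : Fin (n + 2) → ℝ) := by
    intro j
    ext l
    simp [toR, Pi.single_apply]
  have hAT : (Matrix.of A).map (fun m : ℤ => (m : ℝ)) =
      Matrix.diagonal (fun l : Fin (n + 2) => (weightDen n l : ℝ)) * coordMatrix T := by
    ext l j
    rw [Matrix.diagonal_mul]
    simp [← hA, coordMatrix, intForm_apply, hsingle]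
  have hAdet : |((Matrix.of A).det : ℝ)| = 1 := by
    have h1 : ((Matrix.of A).det : ℝ) = ((Matrix.of A).map (fun m : ℤ => (m : ℝ))).det :=
      Int.cast_det _
    rw [h1, hAT, Matrix.det_mul, Matrix.det_diagonal, abs_mul, hdet,
      abs_of_pos (Finset.prod_pos fun (l : Fin (n + 2)) _ => hw l), ← Finset.prod_mul_distrib]
    refine Finset.prod_eq_one fun l _ => ?_
    rw [hβ, Fin.val_castSucc, mul_one_div_cancel (hw l).ne']
  have hAv : ∀ i l, ((Matrix.of A).mulVec (v i) l : ℝ) =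
      (if l.castSucc = i then (weightDen n l : ℝ) else 0) - 1 := by
    intro i l
    have h1 : ((Matrix.of A).mulVec (v i) l : ℝ) =
        ((Matrix.of A).map (fun m : ℤ => (m : ℝ))).mulVec (toR (v i)) l := by
      simp [toR, Matrix.mulVec, dotProduct]
    rw [h1, hAT, ← Matrix.mulVec_mulVec, Matrix.mulVec_diagonal, coordMatrix_mulVec,
      h.apply_vertex, hβ, Fin.val_castSucc, mul_sub, mul_one_div_cancel (hw l).ne']
    simp
  refine ⟨Matrix.of A, 0, ?_, ?_⟩
  · rw [Int.isUnit_iff_abs_eq]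
    exact_mod_cast hAdet
  · simp only [image_hullOf, add_zero]
    rw [hullOf, hullOf]
    congr 1
    refine (range_eq_of_rotate (fun j => ?_) ?_).symm
    · ext l
      simp only [toR]
      rw [hAv, mainV_succ]
      by_cases hlj : l = j
      · simp [hlj]
      · simp [hlj]
    · ext l
      simp only [toR]
      rw [hAv, mainV_zero]
      simp [Fin.castSucc_ne_last]

theorem unimodEquiv_of_mult_eq (hn : 3 ≤ n) (hv : IsCanonicalSimplex v)
    (hm : mult v = 3 * (sylv n - 1) ^ 2) : UnimodEquiv (hullOf v) (hullOf (mainV (n + 2))) := by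
  obtain ⟨T, β, h⟩ := hv.exists_isBarycentric
  set σ := Tuple.sort (fun i => -β i)
  have hanti : Antitone (β ∘ σ) := fun i j hij => by
    have := Tuple.monotone_sort (fun i => -β i) hij
    simpa using this
  have := (h.perm σ).unimodEquiv hn hanti (by rw [mult_comp_perm, hm])
  rwa [hullOf_comp_perm] at this

end Forward

section Reverse

theorem IsBarycentric.mem_range_of_hullOf_eq {d : ℕ} {u v : Fin (d + 1) → Fin d → ℤ}
    {T : Fin (d + 1) → (Fin d → ℝ) →ₗ[ℝ] ℝ} {β : Fin (d + 1) → ℝ} (h : IsBarycentric v T β)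
    (huv : hullOf u = hullOf v) (i : Fin (d + 1)) : ∃ j, u j = v i := by
  by_contra! hne
  have hlt : ∀ j, T i (toR (u j)) < 1 - β i := by
    intro j
    have hj : toR (u j) ∈ hullOf v := huv ▸ subset_convexHull ℝ _ ⟨j, rfl⟩
    have hnonneg : ∀ k, -β k ≤ T k (toR (u j)) := by
      intro k
      have hsub : hullOf v ⊆ {x | -β k ≤ T k x} := by
        refine convexHull_min ?_ (convex_halfSpace_ge (T k).isLinear _)
        rintro _ ⟨l, rfl⟩
        rw [Set.mem_ofPred_eq, h.apply_vertex]
        split_ifs <;> linarith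
      exact hsub hj
    by_contra! hle
    refine hne j (toR_injective (sub_eq_zero.1 (h.ext_zero _ fun k => ?_)))
    have hsum : ∑ k, (T k (toR (u j)) + β k) = 1 := by
      rw [Finset.sum_add_distrib, h.sum_apply, h.sum_weight, zero_add]
    rw [map_sub, h.apply_vertex, sub_eq_zero]
    rw [← Finset.add_sum_erase _ _ (Finset.mem_univ i)] at hsum
    have hrest : ∀ k ∈ Finset.univ.erase i, 0 ≤ T k (toR (u j)) + β k := fun k _ => by
      linarith [hnonneg k]
    have hrest0 := Finset.sum_nonneg hrest
    by_cases hk : k = i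
    · subst hk
      rw [if_pos rfl]
      linarith
    · have := Finset.single_le_sum hrest (Finset.mem_erase.2 ⟨hk, Finset.mem_univ k⟩)
      rw [if_neg hk]
      linarith [hnonneg k]
  have hi : toR (v i) ∈ hullOf u := huv ▸ subset_convexHull ℝ _ ⟨i, rfl⟩
  have hsub : hullOf u ⊆ {x | T i x < 1 - β i} := by
    refine convexHull_min ?_ (convex_halfSpace_lt (T i).isLinear _)
    rintro _ ⟨j, rfl⟩
    exact hlt j
  have := hsub hi
  simp [h.apply_vertex] at this

theorem sum_inv_weightDen (n : ℕ) :
    ∑ j : Fin (n + 2), (1 / weightDen n j : ℝ) = 1 - 1 / (3 * ((sylv n : ℝ) - 1)) := by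
  have hS := cast_sylv_sub_one_pos n
  rw [Fin.sum_univ_castSucc, Fin.sum_univ_castSucc]
  simp only [Fin.val_castSucc, Fin.val_last, weightDen_of_le le_rfl,
    weightDen_of_le n.le_succ]
  have h1 : ∑ i : Fin n, (1 / weightDen n i : ℝ) = 1 - 1 / (sylv n - 1) := by
    rw [← sum_inv_sylv, ← Fin.sum_univ_eq_sum_range (fun i => (1 / sylv i : ℝ))]
    exact Finset.sum_congr rfl fun i _ => by rw [weightDen_of_lt i.isLt]
  rw [h1]
  field_simp
  ring

theorem prod_weightDen (n : ℕ) :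
    ∏ j : Fin (n + 2), (weightDen n j : ℝ) = (sylv n - 1) * (3 * ((sylv n : ℝ) - 1)) ^ 2 := by
  rw [Fin.prod_univ_castSucc, Fin.prod_univ_castSucc]
  simp only [Fin.val_castSucc, Fin.val_last, weightDen_of_le le_rfl,
    weightDen_of_le n.le_succ]
  have h1 : ∏ i : Fin n, (weightDen n i : ℝ) = sylv n - 1 := by
    rw [← prod_sylv, ← Fin.prod_univ_eq_prod_range (fun i => (sylv i : ℝ))]
    exact Finset.prod_congr rfl fun i _ => by rw [weightDen_of_lt i.isLt]
  rw [h1]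
  ring

theorem mainV_zero_mem_closure (n : ℕ) :
    mainV (n + 2) 0 ∈
      AddSubgroup.closure (Set.range fun j : Fin (n + 2) => mainV (n + 2) j.succ) := by
  choose q hq using weightDen_dvd n
  have hsum : (∑ j : Fin (n + 2), (q j : ℤ)) = 3 * (sylv n - 1 : ℕ) - 1 := by
    have hS := cast_sylv_sub_one_pos n
    have h1 := sum_inv_weightDen n
    have h2 : ∀ j : Fin (n + 2), (q j : ℝ) = 3 * ((sylv n - 1 : ℕ) : ℝ) * (1 / weightDen n j) := by
      intro j
      have hw : (0 : ℝ) < weightDen n j := by exact_mod_cast weightDen_pos n j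
      have : 3 * ((sylv n - 1 : ℕ) : ℝ) = weightDen n j * q j := by exact_mod_cast hq j
      rw [this]
      field_simp
    have h3 : (∑ j : Fin (n + 2), (q j : ℝ)) = 3 * ((sylv n - 1 : ℕ) : ℝ) - 1 := by
      rw [Finset.sum_congr rfl fun j _ => h2 j, ← Finset.mul_sum, h1, cast_sylv_sub_one]
      field_simp
    exact_mod_cast h3
  have hmain : mainV (n + 2) 0 = -∑ j : Fin (n + 2), q j • mainV (n + 2) j.succ := by
    ext l
    have hql : ((weightDen n l : ℤ)) * q l = 3 * (sylv n - 1 : ℕ) := by exact_mod_cast (hq l).symm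
    simp [mainV_zero, mainV_succ, mul_sub, Finset.sum_sub_distrib, hsum]
    linarith
  rw [hmain]
  exact neg_mem (sum_mem fun j _ => nsmul_mem (AddSubgroup.subset_closure (Set.mem_range_self j)) _)

theorem mult_mainV (n : ℕ) : mult (mainV (n + 2)) = 3 * (sylv n - 1) ^ 2 := by
  set V : Matrix (Fin (n + 2)) (Fin (n + 2)) ℤ := Matrix.of fun j => mainV (n + 2) j.succ with hV
  have hS := cast_sylv_sub_one_pos n
  have hw : ∀ j, (0 : ℝ) < weightDen n j := fun j => by exact_mod_cast weightDen_pos n j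
  have hVmul : V.map ((↑) : ℤ → ℝ) =
      (1 - Matrix.vecMulVec (fun _ => 1) fun j : Fin (n + 2) => (1 / weightDen n j : ℝ)) *
        Matrix.diagonal fun j : Fin (n + 2) => (weightDen n j : ℝ) := by
    ext j l
    rw [Matrix.mul_diagonal]
    have := (hw l).ne'
    simp only [hV, Matrix.map_apply, Matrix.of_apply, mainV_succ, Matrix.sub_apply,
      Matrix.one_apply, Matrix.vecMulVec_apply]
    obtain rfl | hjl := eq_or_ne j l
    · simp
      field_simp
    · simp [hjl, hjl.symm]
      field_simp
  have hdet : V.det = 3 * (sylv n - 1 : ℕ) ^ 2 := by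
    have h1 : (V.det : ℝ) = (V.map ((↑) : ℤ → ℝ)).det := Int.cast_det _
    rw [hVmul, Matrix.det_mul, det_one_sub_vecMulVec, Matrix.det_diagonal, prod_weightDen] at h1
    simp only [one_mul, sum_inv_weightDen] at h1
    have h2 : (V.det : ℝ) = 3 * ((sylv n - 1 : ℕ) : ℝ) ^ 2 := by
      rw [h1, cast_sylv_sub_one]
      field_simp
      ring
    exact_mod_cast h2
  have hpos : 0 < sylv n - 1 := by have := two_le_sylv n; omega
  have hindex := index_closure_range V (by rw [hdet]; positivity)
  have hcl : AddSubgroup.closure (Set.range (mainV (n + 2))) =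
      AddSubgroup.closure (Set.range V.row) := by
    refine le_antisymm ((AddSubgroup.closure_le _).2 ?_) (AddSubgroup.closure_mono ?_)
    · rintro _ ⟨i, rfl⟩
      induction i using Fin.cases with
      | zero => exact mainV_zero_mem_closure n
      | succ j => exact AddSubgroup.subset_closure ⟨j, rfl⟩
    · rintro _ ⟨j, rfl⟩
      exact ⟨j.succ, rfl⟩
  rw [mult, hcl, hindex, hdet]
  norm_cast

theorem sum_smul_mainV (n : ℕ) :
    ∃ c : Fin (n + 2 + 1) → ℝ, (∀ i, 0 < c i) ∧ ∑ i, c i = 1 ∧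
      ∑ i, c i • toR (mainV (n + 2) i) = 0 := by
  have hS := cast_sylv_sub_one_pos n
  have hw : ∀ j, (0 : ℝ) < weightDen n j := fun j => by exact_mod_cast weightDen_pos n j
  have hsum : ∑ i, (Fin.cons (1 / (3 * ((sylv n : ℝ) - 1))) fun j : Fin (n + 2) =>
      (1 / weightDen n j : ℝ) : Fin (n + 2 + 1) → ℝ) i = 1 := by
    rw [Fin.sum_univ_succ]
    simp only [Fin.cons_zero, Fin.cons_succ, sum_inv_weightDen]
    ring
  refine ⟨_, fun i => ?_, hsum, ?_⟩
  · induction i using Fin.cases with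
    | zero => simp only [Fin.cons_zero]; positivity
    | succ j => simpa using hw j
  · ext l
    have := (hw l).ne'
    rw [Fin.sum_univ_succ] at hsum ⊢
    simp only [Fin.cons_zero, Fin.cons_succ] at hsum ⊢
    simp [toR, mainV_zero, mainV_succ, mul_sub, Finset.sum_sub_distrib, this] at hsum ⊢
    linarith

theorem mult_eq_of_mulVec_eq {d : ℕ} {u v : Fin (d + 1) → Fin d → ℤ}
    {A B : Matrix (Fin d) (Fin d) ℤ} (hAB : A * B = 1) (hBA : B * A = 1)
    (h : ∀ i, A.mulVec (v i) = u i) : mult u = mult v := by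
  have hbij : Function.Bijective A.mulVecLin.toAddMonoidHom := by
    refine Function.bijective_iff_has_inverse.2 ⟨B.mulVec, fun x => ?_, fun x => ?_⟩
    · simp [hBA]
    · simp [hAB]
  have hu : u = A.mulVecLin.toAddMonoidHom ∘ v := funext fun i => (h i).symm
  rw [mult, mult, ← AddSubgroup.index_map_of_bijective hbij (AddSubgroup.closure (Set.range v)),
    AddMonoidHom.map_closure, ← Set.range_comp, ← hu]

theorem mult_eq_of_unimodEquiv {n : ℕ} {v : Fin (n + 2 + 1) → Fin (n + 2) → ℤ}
    (hv : IsCanonicalSimplex v) (hequiv : UnimodEquiv (hullOf v) (hullOf (mainV (n + 2)))) :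
    mult v = 3 * (sylv n - 1) ^ 2 := by
  obtain ⟨A, w, hA, hhull⟩ := hequiv
  obtain ⟨T, β, h⟩ := hv.exists_isBarycentric
  have hAB : A * A⁻¹ = 1 := Matrix.mul_nonsing_inv A hA
  have hBA : A⁻¹ * A = 1 := Matrix.nonsing_inv_mul A hA
  set u : Fin (n + 2 + 1) → Fin (n + 2) → ℤ := fun j => A⁻¹.mulVec (mainV (n + 2) j - w) with hu
  have hcast : ∀ (M : Matrix (Fin (n + 2)) (Fin (n + 2)) ℤ) x,
      (M.map fun m : ℤ => (m : ℝ)).mulVec (toR x) = toR (M.mulVec x) := by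
    intro M x
    ext l
    simp [toR, Matrix.mulVec, dotProduct]
  have huv : hullOf u = hullOf v := by
    have hinj : Function.Injective fun x : Fin (n + 2) → ℝ =>
        (A.map fun m : ℤ => (m : ℝ)).mulVec x + toR w := by
      refine (add_left_injective _).comp (Matrix.mulVec_injective_of_isUnit ?_)
      rw [Matrix.isUnit_iff_isUnit_det]
      have : ((A.det : ℤ) : ℝ) = (A.map fun m : ℤ => (m : ℝ)).det := Int.cast_det _
      rw [← this]
      exact hA.map (Int.castRingHom ℝ)
    refine hinj.image_injective ?_
    rw [← hhull, image_hullOf]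
    simp [hu, Matrix.mulVec_mulVec, hAB]
  choose τ hτ using h.mem_range_of_hullOf_eq huv
  have hvinj : Function.Injective v := fun i j hij => hv.1.injective (congrArg toR hij)
  have hτinj : Function.Injective τ := fun i j hij => hvinj (by rw [← hτ, ← hτ, hij])
  set σ := Equiv.ofBijective τ (Finite.injective_iff_bijective.1 hτinj)
  have hAv : ∀ i, A.mulVec ((v ∘ σ.symm) i) = mainV (n + 2) i - w := by
    intro i
    have : v (σ.symm i) = u i := by
      rw [← hτ]
      exact congrArg u (σ.apply_symm_apply i)
    rw [Function.comp_apply, this, hu, Matrix.mulVec_mulVec, hAB, Matrix.one_mulVec]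
  obtain ⟨c, hc0, hc1, hc⟩ := sum_smul_mainV n
  have hw : A⁻¹.mulVec (-w) = 0 := by
    refine (h.perm σ.symm).eq_zero _ fun i => ?_
    have hx : toR (A⁻¹.mulVec (-w)) = ∑ i, c i • toR ((v ∘ σ.symm) i) := by
      have h1 : ∀ i, toR ((v ∘ σ.symm) i) = (A⁻¹.map fun m : ℤ => (m : ℝ)).mulVec
          (toR (mainV (n + 2) i) - toR w) := by
        intro i
        rw [← toR_sub, ← hAv, hcast, Matrix.mulVec_mulVec, hBA, Matrix.one_mulVec]
      simp_rw [h1, ← Matrix.mulVec_smul, ← Matrix.mulVec_sum, smul_sub, Finset.sum_sub_distrib, hc,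
        ← Finset.sum_smul, hc1, one_smul, zero_sub, ← toR_neg, hcast]
    rw [hx, (h.perm σ.symm).apply_sum, hc1, one_mul]
    linarith [hc0 i]
  have hw0 : w = 0 := by
    have := congrArg A.mulVec hw
    rwa [Matrix.mulVec_mulVec, hAB, Matrix.one_mulVec, Matrix.mulVec_zero, neg_eq_zero] at this
  rw [← mult_comp_perm v σ.symm, ← mult_mainV]
  exact (mult_eq_of_mulVec_eq hAB hBA fun i => by rw [hAv, hw0, sub_zero]).symm

end Reverse

/-- Equality case: for `d ≥ 5`, a `d`-dimensional canonical lattice simplex has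
multiplicity `3 (s_{d-1}-1)^2` iff it is unimodularly equivalent to
`conv{0, s_1 e_1, …, s_{d-2} e_{d-2}, 3(s_{d-1}-1) e_{d-1}, 3(s_{d-1}-1) e_d} - (1,…,1)`. -/
theorem mult_eq_iff_of_canonical {d : ℕ} (hd : 5 ≤ d) (v : Fin (d + 1) → Fin d → ℤ)
    (hv : IsCanonicalSimplex v) :
    mult v = 3 * (sylv (d - 2) - 1) ^ 2 ↔ UnimodEquiv (hullOf v) (hullOf (mainV d)) := by
  obtain ⟨n, rfl⟩ := Nat.exists_eq_add_of_le' (show 2 ≤ d by omega)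
  rw [Nat.add_sub_cancel]
  exact ⟨unimodEquiv_of_mult_eq (by omega) hv, mult_eq_of_unimodEquiv hv⟩
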